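/- Let (F, φ) be a TC flow on D² admitting a first strong integral f. Then for every h ∈ E⁺(F) there exist g ∈ E⁺(F) and continuous maps H₁, H₂ : [0,1] × D² → D² such that H₁(t,·) ∈ E⁺(F) and H₂(t,·) ∈ E⁺(F) for all t ∈ [0,1], H₁(0,·) = g ∘ h, H₁(1,·) = id_{D²}, H₂(0,·) = h ∘ g, and H₂(1,·) = id_{D²}. In other words, in the compact-open topology the semigroup of path components π₀E⁺(F) is a group: every element has a two-sided inverse. -/

import Mathlib

open Set

noncomputable section

/-- Points of the plane. -/
abbrev Pt : Type := ℝ × ℝ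

/-- The closed unit disk `D² = {x² + y² ≤ 1}`. -/
def diskD : Set Pt := {p | p.1 ^ 2 + p.2 ^ 2 ≤ 1}

/-- The origin `O = (0,0)`. -/
def ptO : Pt := (0, 0)

/-- The boundary circle `∂D² = {x² + y² = 1}`. -/
def bdD : Set Pt := {p | p.1 ^ 2 + p.2 ^ 2 = 1}

/-- A TC ("topological center") flow on the disk `D²`: a `C^∞` vector field `F` on `D²`
together with its flow `φ`, such that `O` is the unique singular point of `F` in `D²`,
the boundary circle is an orbit, and every nonsingular point is periodic. -/
structure TCFlow where
  /-- the vector field -/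
  F : Pt → Pt
  /-- the flow of `F` -/
  φ : Pt → ℝ → Pt
  F_smooth : ContDiffOn ℝ (⊤ : ℕ∞) F diskD
  φ_smooth : ContDiffOn ℝ (⊤ : ℕ∞) (fun p : Pt × ℝ => φ p.1 p.2) (diskD ×ˢ (univ : Set ℝ))
  φ_mapsTo : ∀ z ∈ diskD, ∀ t : ℝ, φ z t ∈ diskD
  φ_zero : ∀ z ∈ diskD, φ z 0 = z
  φ_add : ∀ z ∈ diskD, ∀ s t : ℝ, φ (φ z s) t = φ z (s + t)
  φ_deriv : ∀ z ∈ diskD, ∀ t : ℝ, HasDerivAt (φ z) (F (φ z t)) t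
  F_zero_iff : ∀ z ∈ diskD, (F z = 0 ↔ z = ptO)
  bd_orbit : ∀ z ∈ bdD, {p : Pt | ∃ t : ℝ, φ z t = p} = bdD
  periodic : ∀ z ∈ diskD, z ≠ ptO → ∃ t : ℝ, 0 < t ∧ φ z t = z

/-- The orbit of a point under the flow. -/
def orb (Φ : TCFlow) (z : Pt) : Set Pt := Set.range (Φ.φ z)

/-- `h ∈ E(F)`: a `C^∞` self-map of `D²` preserving each orbit of `F` and restricting to a
`C^∞` diffeomorphism between some open neighbourhoods of `O` in `D²`. -/
def Emem (Φ : TCFlow) (h : Pt → Pt) : Prop :=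
  Set.MapsTo h diskD diskD ∧
  ContDiffOn ℝ (⊤ : ℕ∞) h diskD ∧
  (∀ z ∈ diskD, h '' orb Φ z = orb Φ z) ∧
  (∃ U V : Set Pt, IsOpen U ∧ IsOpen V ∧ ptO ∈ U ∧ ptO ∈ V ∧ U ⊆ diskD ∧ V ⊆ diskD ∧
    Set.BijOn h U V ∧
    ∃ g : Pt → Pt, ContDiffOn ℝ (⊤ : ℕ∞) g V ∧ ∀ z ∈ U, g (h z) = z)

/-- `h ∈ E⁺(F)`: an element of `E(F)` with positive Jacobian determinant at `O`. -/
def EplMem (Φ : TCFlow) (h : Pt → Pt) : Prop :=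
  Emem Φ h ∧ 0 < LinearMap.det ((fderiv ℝ h ptO) : Pt →ₗ[ℝ] Pt)

/-- `h ∈ E^∂(F)`: an element of `E⁺(F)` fixed on the boundary circle. -/
def EbdMem (Φ : TCFlow) (h : Pt → Pt) : Prop :=
  EplMem Φ h ∧ ∀ z ∈ bdD, h z = z

/-- `h ∈ D(F)`: an element of `E(F)` which is a `C^∞` diffeomorphism of `D²` onto itself. -/
def DmemTC (Φ : TCFlow) (h : Pt → Pt) : Prop :=
  Emem Φ h ∧ Set.BijOn h diskD diskD ∧
  ∃ g : Pt → Pt, ContDiffOn ℝ (⊤ : ℕ∞) g diskD ∧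
    (∀ z ∈ diskD, g (h z) = z) ∧ (∀ z ∈ diskD, h (g z) = z)

/-- `h ∈ D⁺(F) = D(F) ∩ E⁺(F)`. -/
def DplMem (Φ : TCFlow) (h : Pt → Pt) : Prop := DmemTC Φ h ∧ EplMem Φ h

/-- `h ∈ D^∂(F) = D(F) ∩ E^∂(F)`. -/
def DbdMem (Φ : TCFlow) (h : Pt → Pt) : Prop := DmemTC Φ h ∧ EbdMem Φ h

/-- `h ∈ Sh(F)`: `h` is the shift along orbits of `F` via some `C^∞` function
`α : D² → ℝ`. -/
def ShMem (Φ : TCFlow) (h : Pt → Pt) : Prop :=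
  ∃ α : Pt → ℝ, ContDiffOn ℝ (⊤ : ℕ∞) α diskD ∧ ∀ z ∈ diskD, h z = Φ.φ z (α z)

/-- A first strong integral for a TC flow: a continuous function `f : D² → [0,1]`, `C^∞`
and without critical points on `D² ∖ {O}`, with `f⁻¹(0) = {O}`, `f⁻¹(1) = ∂D²`, and whose
level sets are exactly the orbits of the flow. -/
def FirstStrongIntegral (Φ : TCFlow) (f : Pt → ℝ) : Prop :=
  ContinuousOn f diskD ∧
  Set.MapsTo f diskD (Icc (0 : ℝ) 1) ∧
  ContDiffOn ℝ (⊤ : ℕ∞) f (diskD \ {ptO}) ∧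
  (∀ z ∈ diskD \ {ptO}, fderivWithin ℝ f (diskD \ {ptO}) z ≠ 0) ∧
  (∀ z ∈ diskD, (f z = 0 ↔ z = ptO)) ∧
  (∀ z ∈ diskD, (f z = 1 ↔ z ∈ bdD)) ∧
  (∀ c ∈ Icc (0 : ℝ) 1, ∃ z ∈ diskD, {w ∈ diskD | f w = c} = orb Φ z)

/-- `θ` is the minimal period function of the TC flow `Φ` on `D² ∖ {O}`. -/
def IsMinPeriod (Φ : TCFlow) (θ : Pt → ℝ) : Prop :=
  ∀ z ∈ diskD \ {ptO},
    0 < θ z ∧ Φ.φ z (θ z) = z ∧ ∀ t : ℝ, 0 < t → t < θ z → Φ.φ z t ≠ z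

section
open Filter Topology
lemma disk_closed : IsClosed diskD :=
  isClosed_le (by fun_prop) continuous_const

lemma disk_compact : IsCompact diskD := by
  refine Metric.isCompact_of_isClosed_isBounded disk_closed ?_
  refine (Metric.isBounded_closedBall (x := (0 : Pt)) (r := 1)).subset ?_
  intro p hp
  have hp' : p.1 ^ 2 + p.2 ^ 2 ≤ 1 := hp
  rw [mem_closedBall_zero_iff, Prod.norm_def]
  refine max_le ?_ ?_ <;> rw [Real.norm_eq_abs] <;> apply abs_le_one_iff_mul_self_le_one.2 <;> nlinarith [sq_nonneg p.1, sq_nonneg p.2]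

lemma disk_convex : Convex ℝ diskD := by
  intro x hx y hy a b ha hb hab
  simp only [diskD, mem_ofPred_eq] at *
  simp only [Prod.fst_add, Prod.smul_fst, Prod.snd_add, Prod.smul_snd, smul_eq_mul]
  obtain rfl : b = 1 - a := by linarith
  nlinarith [mul_nonneg ha hb, mul_nonneg (mul_nonneg ha hb) (sq_nonneg (x.1 - y.1)), mul_nonneg (mul_nonneg ha hb) (sq_nonneg (x.2 - y.2))]

def odisk : Set Pt := {p | p.1 ^ 2 + p.2 ^ 2 < 1}

lemma odisk_open : IsOpen odisk := isOpen_lt (by fun_prop) continuous_const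

lemma odisk_sub : odisk ⊆ diskD := fun p hp => le_of_lt (show p.1 ^ 2 + p.2 ^ 2 < 1 from hp)

lemma ptO_odisk : ptO ∈ odisk := by simp [odisk, ptO]

lemma disk_nhds {z : Pt} (hz : z ∈ odisk) : diskD ∈ 𝓝 z :=
  mem_of_superset (odisk_open.mem_nhds hz) odisk_sub

lemma disk_cases {z : Pt} (hz : z ∈ diskD) : z ∈ odisk ∨ z ∈ bdD :=
  lt_or_eq_of_le (show z.1 ^ 2 + z.2 ^ 2 ≤ 1 from hz)

lemma disk_udiff : UniqueDiffOn ℝ diskD :=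
  uniqueDiffOn_convex disk_convex ⟨ptO, mem_interior_iff_mem_nhds.2 (disk_nhds ptO_odisk)⟩

lemma pdisk_udiff : UniqueDiffOn ℝ (diskD \ {ptO}) := by
  rw [sdiff_eq]
  exact disk_udiff.inter isOpen_compl_singleton

/-- a punctured-disk point -/
lemma pdisk_nhdsWithin {z : Pt} (hz : z ∈ diskD \ {ptO}) :
    𝓝[diskD \ {ptO}] z = 𝓝[diskD] z := by
  rw [sdiff_eq]
  exact nhdsWithin_inter_of_mem' (mem_nhdsWithin_of_mem_nhds (isOpen_compl_singleton.mem_nhds hz.2))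

variable {Φ : TCFlow} {f : Pt → ℝ}

namespace TCFlow
lemma φ_cont (Φ : TCFlow) : ContinuousOn (fun p : Pt × ℝ => Φ.φ p.1 p.2) (diskD ×ˢ (univ : Set ℝ)) :=
  Φ.φ_smooth.continuousOn

lemma φ_cont' (Φ : TCFlow) {z : Pt} (hz : z ∈ diskD) : Continuous (Φ.φ z) :=
  continuous_iff_continuousAt.2 fun t => (Φ.φ_deriv z hz t).continuousAt

lemma φ_comp {X : Type*} [TopologicalSpace X] (Φ : TCFlow) {s : Set X} {a : X → Pt} {b : X → ℝ}
    (ha : ContinuousOn a s) (hb : ContinuousOn b s) (hm : MapsTo a s diskD) :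
    ContinuousOn (fun x => Φ.φ (a x) (b x)) s :=
  Φ.φ_cont.comp (ha.prodMk hb) (fun x hx => ⟨hm hx, mem_univ _⟩)

lemma φ_neg (Φ : TCFlow) {z w : Pt} (hz : z ∈ diskD) {t : ℝ} (h : Φ.φ z t = w) : Φ.φ w (-t) = z := by
  rw [← h, Φ.φ_add z hz, add_neg_cancel, Φ.φ_zero z hz]
end TCFlow

lemma orb_eq {z : Pt} (hz : z ∈ diskD) {w : Pt} (hw : w ∈ orb Φ z) : orb Φ w = orb Φ z := by
  obtain ⟨t, rfl⟩ := hw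
  ext u; constructor
  · rintro ⟨s, rfl⟩; exact ⟨t + s, (Φ.φ_add z hz t s).symm⟩
  · rintro ⟨s, rfl⟩; exact ⟨s - t, by rw [Φ.φ_add z hz]; congr 1; ring⟩

lemma self_orb {z : Pt} (hz : z ∈ diskD) : z ∈ orb Φ z := ⟨0, Φ.φ_zero z hz⟩

lemma orb_sub {z : Pt} (hz : z ∈ diskD) : orb Φ z ⊆ diskD := by
  rintro _ ⟨t, rfl⟩; exact Φ.φ_mapsTo z hz t

namespace FirstStrongIntegral
variable (hf : FirstStrongIntegral Φ f)
include hf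
lemma cont : ContinuousOn f diskD := hf.1
lemma nonneg {z} (hz : z ∈ diskD) : 0 ≤ f z := (hf.2.1 hz).1
lemma le_one {z} (hz : z ∈ diskD) : f z ≤ 1 := (hf.2.1 hz).2
lemma smooth : ContDiffOn ℝ (⊤ : ℕ∞) f (diskD \ {ptO}) := hf.2.2.1
lemma zero_iff {z} (hz : z ∈ diskD) : f z = 0 ↔ z = ptO := hf.2.2.2.2.1 z hz
lemma one_iff {z} (hz : z ∈ diskD) : f z = 1 ↔ z ∈ bdD := hf.2.2.2.2.2.1 z hz
lemma level {z} (hz : z ∈ diskD) : {w ∈ diskD | f w = f z} = orb Φ z := by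
  obtain ⟨z', hz', h⟩ := hf.2.2.2.2.2.2 (f z) (hf.2.1 hz)
  have : z ∈ orb Φ z' := h ▸ ⟨hz, rfl⟩
  rw [h, orb_eq hz' this]
lemma exists_level {c} (hc : c ∈ Icc (0:ℝ) 1) : ∃ z ∈ diskD, f z = c := by
  obtain ⟨z', hz', h⟩ := hf.2.2.2.2.2.2 c hc
  have : z' ∈ orb Φ z' := self_orb hz'
  rw [← h] at this
  exact ⟨z', this⟩
lemma orb_iff {z w} (hz : z ∈ diskD) : w ∈ orb Φ z ↔ w ∈ diskD ∧ f w = f z := by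
  rw [← hf.level hz]; rfl
lemma f_φ {z} (hz : z ∈ diskD) (t : ℝ) : f (Φ.φ z t) = f z :=
  ((hf.orb_iff hz).1 ⟨t, rfl⟩).2
lemma conn {z w} (hz : z ∈ diskD) (hw : w ∈ diskD) (h : f w = f z) : ∃ t, Φ.φ z t = w :=
  (hf.orb_iff hz).2 ⟨hw, h⟩
lemma pos {z} (hz : z ∈ diskD \ {ptO}) : 0 < f z :=
  lt_of_le_of_ne (hf.nonneg hz.1) (fun h => hz.2 ((hf.zero_iff hz.1).1 h.symm))
lemma mem_p {z} (hz : z ∈ diskD) (h : 0 < f z) : z ∈ diskD \ {ptO} :=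
  ⟨hz, fun h' => h.ne' ((hf.zero_iff hz).2 h')⟩
lemma φ_mem_p {z} (hz : z ∈ diskD \ {ptO}) (t : ℝ) : Φ.φ z t ∈ diskD \ {ptO} :=
  hf.mem_p (Φ.φ_mapsTo z hz.1 t) (by rw [hf.f_φ hz.1]; exact hf.pos hz)
lemma F_ne {z} (hz : z ∈ diskD \ {ptO}) : Φ.F z ≠ 0 := fun h => hz.2 ((Φ.F_zero_iff z hz.1).1 h)
lemma f_h {h : Pt → Pt} (hh : Emem Φ h) {z} (hz : z ∈ diskD) : f (h z) = f z := by
  have : h z ∈ orb Φ z := by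
    rw [← hh.2.2.1 z hz]; exact ⟨z, self_orb hz, rfl⟩
  exact ((hf.orb_iff hz).1 this).2
lemma hasF {z} (hz : z ∈ diskD \ {ptO}) :
    HasFDerivWithinAt f (fderivWithin ℝ f (diskD \ {ptO}) z) (diskD \ {ptO}) z :=
  ((hf.smooth.differentiableOn (by simp)) z hz).hasFDerivWithinAt
lemma dF {z} (hz : z ∈ diskD \ {ptO}) : fderivWithin ℝ f (diskD \ {ptO}) z (Φ.F z) = 0 := by
  have h1 : HasDerivAt (Φ.φ z) (Φ.F z) 0 := by
    simpa [Φ.φ_zero z hz.1] using Φ.φ_deriv z hz.1 0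
  have h2 := hf.hasF (z := Φ.φ z 0) (by rw [Φ.φ_zero z hz.1]; exact hz)
  have h3 := h2.comp_hasDerivAt (0:ℝ) h1 (Eventually.of_forall fun t => hf.φ_mem_p hz t)
  rw [Φ.φ_zero z hz.1] at h3
  have h4 : f ∘ Φ.φ z = fun _ => f z := by
    ext t; exact hf.f_φ hz.1 t
  rw [h4] at h3
  exact h3.unique (hasDerivAt_const _ _)

end FirstStrongIntegral

/-- cross product -/
def crs (v w : Pt) : ℝ := v.1 * w.2 - v.2 * w.1
/-- dot product -/
def dt (v w : Pt) : ℝ := v.1 * w.1 + v.2 * w.2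

lemma dt_self_pos {v : Pt} (h : v ≠ 0) : 0 < dt v v := by
  have : v.1 ≠ 0 ∨ v.2 ≠ 0 := by
    by_contra! h'; exact h (Prod.ext h'.1 h'.2)
  unfold dt
  rcases this with h | h
  · have := mul_self_pos.2 h; nlinarith [mul_self_nonneg v.2]
  · have := mul_self_pos.2 h; nlinarith [mul_self_nonneg v.1]

def kap (Φ : TCFlow) (f : Pt → ℝ) (z : Pt) : ℝ :=
  fderivWithin ℝ f (diskD \ {ptO}) z (-(Φ.F z).2, (Φ.F z).1) / dt (Φ.F z) (Φ.F z)

lemma lin_expand (L : Pt →L[ℝ] ℝ) (w : Pt) : L w = L (1,0) * w.1 + L (0,1) * w.2 := by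
  have : w = w.1 • ((1:ℝ),(0:ℝ)) + w.2 • ((0:ℝ),(1:ℝ)) := by ext <;> simp
  conv_lhs => rw [this, map_add, map_smul, map_smul]
  simp [mul_comm]

lemma lin_crs (L : Pt →L[ℝ] ℝ) (v : Pt) (hv : v ≠ 0) (hL : L v = 0) (w : Pt) :
    L w = (L (-v.2, v.1) / dt v v) * crs v w := by
  have := (dt_self_pos hv).ne'
  rw [lin_expand] at hL
  rw [lin_expand, lin_expand L (-v.2, v.1)]
  rw [div_mul_eq_mul_div, eq_div_iff this]
  simp only [dt, crs]
  linear_combination (v.1 * w.1 + v.2 * w.2) * hL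

namespace FirstStrongIntegral
variable (hf : FirstStrongIntegral Φ f)
include hf
lemma L_eq {z} (hz : z ∈ diskD \ {ptO}) (w : Pt) :
    fderivWithin ℝ f (diskD \ {ptO}) z w = kap Φ f z * crs (Φ.F z) w :=
  lin_crs _ _ (hf.F_ne hz) (hf.dF hz) w
lemma kap_ne {z} (hz : z ∈ diskD \ {ptO}) : kap Φ f z ≠ 0 := by
  intro h
  apply hf.2.2.2.1 z hz
  ext w <;> simp [hf.L_eq hz, h]
lemma contL : ContinuousOn (fderivWithin ℝ f (diskD \ {ptO})) (diskD \ {ptO}) :=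
  hf.smooth.continuousOn_fderivWithin pdisk_udiff (by simp)
lemma kap_cont : ContinuousOn (kap Φ f) (diskD \ {ptO}) := by
  have hF : ContinuousOn Φ.F (diskD \ {ptO}) := Φ.F_smooth.continuousOn.mono sdiff_subset
  unfold kap
  refine ContinuousOn.div (hf.contL.clm_apply (by fun_prop)) (by unfold dt; fun_prop) ?_
  intro z hz; exact (dt_self_pos (hf.F_ne hz)).ne'
lemma kap_sign {z} (hz : z ∈ diskD \ {ptO}) (t : ℝ) : 0 < kap Φ f z * kap Φ f (Φ.φ z t) := by
  have hc : Continuous (fun s => kap Φ f z * kap Φ f (Φ.φ z s)) := by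
    refine continuous_const.mul ?_
    exact hf.kap_cont.comp_continuous (Φ.φ_cont' hz.1) (fun s => hf.φ_mem_p hz s)
  by_contra! h
  have h0 : 0 < kap Φ f z * kap Φ f (Φ.φ z 0) := by
    rw [Φ.φ_zero z hz.1]; exact mul_self_pos.2 (hf.kap_ne hz)
  obtain ⟨s, hs⟩ := mem_range_of_exists_le_of_exists_ge hc ⟨t, h⟩ ⟨0, h0.le⟩
  exact mul_ne_zero (hf.kap_ne hz) (hf.kap_ne (hf.φ_mem_p hz s)) hs
end FirstStrongIntegral
end

section
open Filter Topology
variable {Φ : TCFlow} {f : Pt → ℝ}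

lemma nhds_disk_prod {z : Pt} {t : ℝ} {p : Pt → ℝ → Prop}
    (h : ∀ᶠ q : Pt × ℝ in 𝓝[diskD ×ˢ (univ : Set ℝ)] (z, t), p q.1 q.2) :
    ∃ r > 0, ∀ w ∈ diskD, dist w z < r → ∀ s, dist s t < r → p w s := by
  obtain ⟨r, hr, h'⟩ := Metric.mem_nhdsWithin_iff.1 h
  refine ⟨r, hr, fun w hw hwz s hs => ?_⟩
  exact h' (a := (w, s)) ⟨by rw [Metric.mem_ball, Prod.dist_eq]; exact max_lt hwz hs, hw, mem_univ _⟩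

lemma hd_fst {a : ℝ → Pt} {a' : Pt} {t : ℝ} (h : HasDerivAt a a' t) :
    HasDerivAt (fun s => (a s).1) a'.1 t :=
  (ContinuousLinearMap.fst ℝ ℝ ℝ).hasFDerivAt.comp_hasDerivAt t h

lemma hd_snd {a : ℝ → Pt} {a' : Pt} {t : ℝ} (h : HasDerivAt a a' t) :
    HasDerivAt (fun s => (a s).2) a'.2 t :=
  (ContinuousLinearMap.snd ℝ ℝ ℝ).hasFDerivAt.comp_hasDerivAt t h

namespace FirstStrongIntegral
variable (hf : FirstStrongIntegral Φ f)
include hf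

lemma mv {z : Pt} (hz : z ∈ diskD \ {ptO}) {ε : ℝ} (hε : 0 < ε) :
    ∃ r > 0, ∀ w ∈ diskD, ∀ w' ∈ diskD, dist w z < r → dist w' z < r →
      |f w' - f w - fderivWithin ℝ f (diskD \ {ptO}) z (w' - w)| ≤ ε * ‖w' - w‖ := by
  have h1 : ∀ᶠ x in 𝓝[diskD] z, x ∈ diskD \ {ptO} ∧
      ‖fderivWithin ℝ f (diskD \ {ptO}) x - fderivWithin ℝ f (diskD \ {ptO}) z‖ ≤ ε := by
    rw [← pdisk_nhdsWithin hz]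
    refine Filter.Eventually.and self_mem_nhdsWithin ?_
    have := (hf.contL z hz).sub (continuousWithinAt_const (b := fderivWithin ℝ f (diskD \ {ptO}) z))
    have := this.norm
    refine (this.eventually (gt_mem_nhds (by simpa using hε))).mono fun x hx => le_of_lt hx
  obtain ⟨r, hr, h2⟩ := Metric.mem_nhdsWithin_iff.1 h1
  refine ⟨r, hr, fun w hw w' hw' hwr hwr' => ?_⟩
  have hs : Metric.ball z r ∩ diskD ⊆ diskD \ {ptO} := fun x hx => (h2 hx).1
  have := Convex.norm_image_sub_le_of_norm_hasFDerivWithin_le' (f := f)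
    (f' := fderivWithin ℝ f (diskD \ {ptO})) (s := Metric.ball z r ∩ diskD) (C := ε)
    (φ := fderivWithin ℝ f (diskD \ {ptO}) z) (x := w) (y := w')
    (fun x hx => (hf.hasF (hs hx)).mono hs) (fun x hx => (h2 hx).2)
    ((convex_ball z r).inter disk_convex) ⟨hwr, hw⟩ ⟨hwr', hw'⟩
  exact this

lemma inj {z : Pt} (hz : z ∈ diskD \ {ptO}) :
    ∃ r > 0, ∀ w ∈ diskD, ∀ w' ∈ diskD, dist w z < r → dist w' z < r →
      f w = f w' → dt (Φ.F z) w = dt (Φ.F z) w' → w = w' := by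
  set κ := kap Φ f z
  set v := Φ.F z
  have hκ : κ ≠ 0 := hf.kap_ne hz
  have hv : 0 < dt v v := dt_self_pos (hf.F_ne hz)
  have hε : 0 < |κ| * √(dt v v) / 2 := by positivity
  obtain ⟨r, hr, h⟩ := hf.mv hz hε
  refine ⟨r, hr, fun w hw w' hw' h1 h2 h3 h4 => ?_⟩
  have h5 := h w hw w' hw' h1 h2
  rw [← h3, sub_self, zero_sub, abs_neg, hf.L_eq hz, abs_mul] at h5
  have h6 : |crs v (w' - w)| ≤ √(dt v v) / 2 * ‖w' - w‖ := by
    have : 0 < |κ| := abs_pos.2 hκ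
    refine le_of_mul_le_mul_left ?_ this
    calc _ ≤ _ := h5
      _ = _ := by ring
  have h7 : dt v (w' - w) = 0 := by
    simp only [dt, Prod.fst_sub, Prod.snd_sub] at h4 ⊢; linarith
  have h8 : (crs v (w' - w))^2 + (dt v (w'-w))^2 = dt v v * dt (w'-w) (w'-w) := by
    simp only [crs, dt]; ring
  have h9 : ‖w' - w‖^2 ≤ dt (w'-w) (w'-w) := by
    rw [Prod.norm_def]
    simp only [dt, Real.norm_eq_abs]
    rcases max_choice |(w'-w).1| |(w'-w).2| with h | h <;> rw [h, sq_abs] <;>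
      nlinarith [sq_nonneg (w'-w).1, sq_nonneg (w'-w).2]
  have h10 : (crs v (w' - w))^2 ≤ dt v v / 4 * ‖w' - w‖^2 := by
    rw [← sq_abs]
    calc _ ≤ (√(dt v v) / 2 * ‖w' - w‖)^2 := by gcongr
      _ = (√(dt v v))^2 / 4 * ‖w' - w‖^2 := by ring
      _ = _ := by rw [Real.sq_sqrt hv.le]
  rw [h7] at h8
  have h11 : ‖w' - w‖^2 ≤ 0 := by
    have : dt v v * ‖w' - w‖^2 ≤ dt v v * (‖w' - w‖^2/4) := by
      calc _ ≤ dt v v * dt (w'-w) (w'-w) := by gcongr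
        _ = _ := h8.symm
        _ ≤ dt v v / 4 * ‖w' - w‖^2 := by linarith
        _ = _ := by ring
    have := le_of_mul_le_mul_left this hv
    linarith
  have h12 : ‖w' - w‖ = 0 := by
    have := sq_nonneg ‖w' - w‖
    exact pow_eq_zero_iff (two_ne_zero) |>.1 (le_antisymm h11 this)
  exact (sub_eq_zero.1 (norm_eq_zero.1 h12)).symm

lemma smono {z : Pt} (hz : z ∈ diskD \ {ptO}) :
    ∃ r > 0, ∀ w ∈ diskD, dist w z < r →
      StrictMonoOn (fun τ => dt (Φ.F z) (Φ.φ w τ)) (Icc (-r) r) := by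
  have hc : ContinuousOn (fun q : Pt × ℝ => dt (Φ.F z) (Φ.F (Φ.φ q.1 q.2)))
      (diskD ×ˢ (univ : Set ℝ)) := by
    have : ContinuousOn (fun q : Pt × ℝ => Φ.F (Φ.φ q.1 q.2)) (diskD ×ˢ (univ : Set ℝ)) :=
      Φ.F_smooth.continuousOn.comp Φ.φ_cont (fun q hq => Φ.φ_mapsTo _ hq.1 _)
    unfold dt; fun_prop
  have h0 : 0 < dt (Φ.F z) (Φ.F (Φ.φ z 0)) := by
    rw [Φ.φ_zero z hz.1]; exact dt_self_pos (hf.F_ne hz)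
  obtain ⟨r, hr, h⟩ := nhds_disk_prod (p := fun w s => 0 < dt (Φ.F z) (Φ.F (Φ.φ w s)))
    ((hc (z, 0) ⟨hz.1, mem_univ _⟩).eventually (lt_mem_nhds h0))
  refine ⟨r / 2, by positivity, fun w hw hwz => ?_⟩
  have hd : ∀ τ, HasDerivAt (fun τ => dt (Φ.F z) (Φ.φ w τ)) (dt (Φ.F z) (Φ.F (Φ.φ w τ))) τ := by
    intro τ
    have := Φ.φ_deriv w hw τ
    have h1 := hd_fst this
    have h2 := hd_snd this
    exact (h1.const_mul _).add (h2.const_mul _)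
  refine strictMonoOn_of_deriv_pos (convex_Icc _ _)
    (fun τ _ => (hd τ).continuousAt.continuousWithinAt) ?_
  intro τ hτ
  rw [interior_Icc] at hτ
  rw [(hd τ).deriv]
  refine h w hw (by linarith) τ ?_
  rw [Real.dist_eq, sub_zero, abs_lt]
  constructor <;> linarith [hτ.1, hτ.2]

lemma noper {z : Pt} (hz : z ∈ diskD \ {ptO}) :
    ∃ r > 0, ∀ w ∈ diskD, dist w z < r → ∀ τ, 0 < τ → τ < r → Φ.φ w τ ≠ w := by
  obtain ⟨r, hr, h⟩ := hf.smono hz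
  refine ⟨r, hr, fun w hw hwz τ h0 h1 h2 => ?_⟩
  have := h w hw hwz (a := 0) (b := τ) ⟨by linarith, by linarith⟩ ⟨by linarith, by linarith⟩ h0
  simp only [Φ.φ_zero w hw, h2] at this
  exact lt_irrefl _ this

lemma dt_cont (v : Pt) : Continuous (dt v) := by unfold dt; fun_prop

lemma fbox {z : Pt} (hz : z ∈ diskD \ {ptO}) {δ : ℝ} (hδ : 0 < δ) :
    ∃ r > 0, ∀ w ∈ diskD, ∀ w' ∈ diskD, dist w z < r → dist w' z < r → f w = f w' →
      ∃ τ, |τ| < δ ∧ Φ.φ w τ = w' := by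
  obtain ⟨r1, hr1, hinj⟩ := hf.inj hz
  obtain ⟨r2, hr2, hmono⟩ := hf.smono hz
  have h1 : ∀ᶠ q : Pt × ℝ in 𝓝[diskD ×ˢ (univ : Set ℝ)] (z, 0), dist (Φ.φ q.1 q.2) z < r1 := by
    have := (Φ.φ_cont (z, 0) ⟨hz.1, mem_univ _⟩)
    have h2 := this.eventually (Metric.ball_mem_nhds _ hr1)
    simpa [Φ.φ_zero z hz.1] using h2
  obtain ⟨r3, hr3, hst⟩ := nhds_disk_prod (p := fun w s => dist (Φ.φ w s) z < r1) h1
  obtain ⟨d, hd, hd1, hd2, hd3⟩ : ∃ d > 0, d < δ ∧ d ≤ r2 ∧ d < r3 := by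
    refine ⟨min (δ/2) (min r2 (r3/2)), by positivity, ?_, ?_, ?_⟩
    · linarith [min_le_left (δ/2) (min r2 (r3/2))]
    · linarith [min_le_right (δ/2) (min r2 (r3/2)), min_le_left r2 (r3/2)]
    · linarith [min_le_right (δ/2) (min r2 (r3/2)), min_le_right r2 (r3/2)]
  have hm := hmono z hz.1 (by simpa using hr2)
  have ha : dt (Φ.F z) (Φ.φ z (-d)) < dt (Φ.F z) z := by
    have := hm (a := -d) (b := 0) ⟨by linarith, by linarith⟩ ⟨by linarith, by linarith⟩ (by linarith)
    simpa [Φ.φ_zero z hz.1] using this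
  have hb : dt (Φ.F z) z < dt (Φ.F z) (Φ.φ z d) := by
    have := hm (a := 0) (b := d) ⟨by linarith, by linarith⟩ ⟨by linarith, by linarith⟩ (by linarith)
    simpa [Φ.φ_zero z hz.1] using this
  have hφc : ∀ s : ℝ, ContinuousWithinAt (fun w => dt (Φ.F z) (Φ.φ w s)) diskD z := by
    intro s
    exact (dt_cont hf _).continuousAt.comp_continuousWithinAt
      (Φ.φ_comp continuousOn_id continuousOn_const (fun x hx => hx) z hz.1)
  obtain ⟨m1, ha1, ha2⟩ := exists_between ha
  obtain ⟨m2, hb1, hb2⟩ := exists_between hb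
  have e1 := (hφc (-d)).eventually (gt_mem_nhds ha1)
  have e2 := (hφc d).eventually (lt_mem_nhds hb2)
  have e3 := ((dt_cont hf (Φ.F z)).continuousWithinAt (s := diskD) (x := z)).eventually (lt_mem_nhds ha2)
  have e4 := ((dt_cont hf (Φ.F z)).continuousWithinAt (s := diskD) (x := z)).eventually (gt_mem_nhds hb1)
  obtain ⟨r4, hr4, he⟩ := Metric.mem_nhdsWithin_iff.1 (((e1.and e2).and e3).and e4)
  refine ⟨min r4 (min r3 r1), by positivity, fun w hw w' hw' hwz hwz' hfe => ?_⟩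
  obtain ⟨hw1, hw2, hw3⟩ : dist w z < r4 ∧ dist w z < r3 ∧ dist w z < r1 := by
    simpa using hwz
  obtain ⟨hw1', hw2', hw3'⟩ : dist w' z < r4 ∧ dist w' z < r3 ∧ dist w' z < r1 := by
    simpa using hwz'
  obtain ⟨⟨⟨g1, g2⟩, -⟩, -⟩ := he (a := w) ⟨hw1, hw⟩
  obtain ⟨⟨-, g3⟩, g4⟩ := he (a := w') ⟨hw1', hw'⟩
  have hcw : ContinuousOn (fun s => dt (Φ.F z) (Φ.φ w s)) (Icc (-d) d) :=
    ((dt_cont hf _).comp (Φ.φ_cont' hw)).continuousOn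
  obtain ⟨τ, hτ, hτe⟩ := intermediate_value_Icc (by linarith : -d ≤ d) hcw
    (show dt (Φ.F z) w' ∈ _ from ⟨(g1.trans g3).le, (g4.trans g2).le⟩)
  have hτd : |τ| ≤ d := abs_le.2 hτ
  refine ⟨τ, by linarith, ?_⟩
  refine hinj _ (Φ.φ_mapsTo w hw τ) w' hw' (hst w hw hw2 τ ?_) hw3' ?_ hτe
  · rw [Real.dist_eq, sub_zero]; linarith
  · rw [hf.f_φ hw, hfe]

/-- segments give local sections -/
lemma locsec_aux {z v : Pt} (hz : z ∈ diskD \ {ptO})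
    (hv : 0 < fderivWithin ℝ f (diskD \ {ptO}) z v) :
    ∃ r > 0, ∃ m > 0, ∀ u u', |u| ≤ r → |u'| ≤ r → z + u • v ∈ diskD → z + u' • v ∈ diskD → u ≤ u' →
      m * (u' - u) ≤ f (z + u' • v) - f (z + u • v) := by
  set l := fderivWithin ℝ f (diskD \ {ptO}) z v
  have hvn : 0 < ‖v‖ := by
    rw [norm_pos_iff]; rintro rfl; simp [l] at hv
  obtain ⟨r, hr, h⟩ := hf.mv hz (ε := l / 2 / ‖v‖) (by positivity)
  refine ⟨r / 2 / ‖v‖, by positivity, l / 2, by positivity, fun u u' hu hu' hd hd' huu => ?_⟩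
  have hdist : ∀ u, |u| ≤ r / 2 / ‖v‖ → dist (z + u • v) z < r := by
    intro u hu
    rw [dist_eq_norm, add_sub_cancel_left, norm_smul, Real.norm_eq_abs]
    rw [le_div_iff₀ hvn] at hu
    linarith
  have := h _ hd _ hd' (hdist u hu) (hdist u' hu')
  rw [show z + u' • v - (z + u • v) = (u' - u) • v by module, map_smul, norm_smul, Real.norm_eq_abs,
    abs_of_nonneg (by linarith : (0:ℝ) ≤ u' - u), smul_eq_mul] at this
  have h2 : l / 2 / ‖v‖ * ((u' - u) * ‖v‖) = l / 2 * (u' - u) := by field_simp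
  rw [h2] at this
  have := (abs_le.1 this).1
  change -(l / 2 * (u' - u)) ≤ f (z + u' • v) - f (z + u • v) - (u' - u) * l at this
  linarith

lemma locsec_seg {z v : Pt} {a b m : ℝ} (hab : a ≤ b) (hm : 0 < m)
    (hd : ∀ u ∈ Icc a b, z + u • v ∈ diskD)
    (hi : ∀ u ∈ Icc a b, ∀ u' ∈ Icc a b, u ≤ u' → m * (u' - u) ≤ f (z + u' • v) - f (z + u • v)) :
    ∃ ρ : ℝ → Pt, ContinuousOn ρ (Icc (f (z + a • v)) (f (z + b • v))) ∧
      ∀ c ∈ Icc (f (z + a • v)) (f (z + b • v)), ρ c ∈ diskD ∧ f (ρ c) = c := by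
  have hc : ContinuousOn (fun u : ℝ => f (z + u • v)) (Icc a b) :=
    hf.cont.comp (by fun_prop) hd
  have hs : ∀ c ∈ Icc (f (z + a • v)) (f (z + b • v)), ∃ u ∈ Icc a b, f (z + u • v) = c :=
    fun c h => intermediate_value_Icc hab hc h
  choose! u hu hfu using hs
  refine ⟨fun c => z + u c • v, ?_, fun c hc => ⟨hd _ (hu c hc), hfu c hc⟩⟩
  have : ContinuousOn u (Icc (f (z + a • v)) (f (z + b • v))) := by
    have : LipschitzOnWith (Real.toNNReal (1 / m)) u (Icc (f (z + a • v)) (f (z + b • v))) := by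
      refine LipschitzOnWith.of_dist_le_mul fun x hx y hy => ?_
      rw [Real.coe_toNNReal _ (by positivity), Real.dist_eq, Real.dist_eq, one_div, ← div_eq_inv_mul,
        le_div_iff₀ hm]
      have ex := hfu x hx
      have ey := hfu y hy
      rcases le_total (u x) (u y) with h | h
      · have := hi _ (hu x hx) _ (hu y hy) h
        rw [ex, ey] at this
        rw [abs_sub_comm, abs_of_nonneg (by linarith), abs_sub_comm]
        linarith [le_abs_self (y - x)]
      · have := hi _ (hu y hy) _ (hu x hx) h
        rw [ex, ey] at this
        rw [abs_of_nonneg (by linarith)]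
        linarith [le_abs_self (x - y)]
    exact this.continuousOn
  fun_prop

lemma locsec {z : Pt} (hz : z ∈ diskD \ {ptO}) :
    ∃ η > 0, ∃ ρ : ℝ → Pt, ContinuousOn ρ (Icc (f z - η) (f z + η) ∩ Iic 1) ∧
      ∀ c ∈ Icc (f z - η) (f z + η) ∩ Iic 1, ρ c ∈ diskD ∧ f (ρ c) = c := by
  rcases disk_cases hz.1 with ho | hb
  · obtain ⟨v, hv⟩ : ∃ v, 0 < fderivWithin ℝ f (diskD \ {ptO}) z v := by
      by_contra! h
      apply hf.2.2.2.1 z hz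
      refine ContinuousLinearMap.ext fun w => le_antisymm (h w) ?_
      have := h (-w)
      rw [map_neg] at this
      simpa using this
    obtain ⟨r, hr, m, hm, hi⟩ := hf.locsec_aux hz hv
    have hc : ContinuousAt (fun u : ℝ => z + u • v) 0 := by fun_prop
    have he : ∀ᶠ u : ℝ in 𝓝 0, z + u • v ∈ diskD :=
      hc.eventually_mem (by simpa using disk_nhds ho)
    obtain ⟨e, he0, he⟩ := Metric.eventually_nhds_iff.1 he
    set d := min r (e / 2)
    have hd0 : 0 < d := by positivity
    have hd1 : d ≤ r := min_le_left _ _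
    have hd2 : d < e := by linarith [min_le_right r (e/2)]
    have hD : ∀ u ∈ Icc (-d) d, z + u • v ∈ diskD := fun u hu =>
      he (by rw [Real.dist_eq, sub_zero]; exact (abs_le.2 hu).trans_lt hd2)
    have hI : ∀ u ∈ Icc (-d) d, ∀ u' ∈ Icc (-d) d, u ≤ u' →
        m * (u' - u) ≤ f (z + u' • v) - f (z + u • v) := fun u hu u' hu' h =>
      hi u u' ((abs_le.2 hu).trans hd1) ((abs_le.2 hu').trans hd1) (hD u hu) (hD u' hu') h
    obtain ⟨ρ, hρ, hρ'⟩ := hf.locsec_seg (by linarith : -d ≤ d) hm hD hI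
    have h1 := hI 0 ⟨by linarith, by linarith⟩ d ⟨by linarith, by linarith⟩ hd0.le
    have h2 := hI (-d) ⟨by linarith, by linarith⟩ 0 ⟨by linarith, by linarith⟩ (by linarith)
    simp only [zero_smul, add_zero, sub_zero, zero_sub, neg_neg] at h1 h2
    have hsub : Icc (f z - m * d) (f z + m * d) ∩ Iic 1 ⊆ Icc (f (z + (-d) • v)) (f (z + d • v)) :=
      fun c hc => ⟨by linarith [hc.1.1], by linarith [hc.1.2]⟩
    exact ⟨m * d, by positivity, ρ, hρ.mono hsub, fun c hc => hρ' c (hsub hc)⟩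
  · -- boundary
    have hb' : z.1 ^ 2 + z.2 ^ 2 = 1 := hb
    have hperp : dt z (Φ.F z) = 0 := by
      have hd := Φ.φ_deriv z hz.1 0
      rw [Φ.φ_zero z hz.1] at hd
      have h1 := hd_fst hd
      have h2 := hd_snd hd
      have h3 := (h1.pow 2).add (h2.pow 2)
      have h4 : ((fun x => (Φ.φ z x).1) ^ 2 + (fun x => (Φ.φ z x).2) ^ 2) = fun _ => (1:ℝ) := by
        ext t
        have : Φ.φ z t ∈ bdD := by rw [← Φ.bd_orbit z hb]; exact ⟨t, rfl⟩
        exact this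
      rw [h4] at h3
      have h5 := h3.unique (hasDerivAt_const _ _)
      simp [Φ.φ_zero z hz.1] at h5
      simp only [dt]; linarith
    have hne : fderivWithin ℝ f (diskD \ {ptO}) z z ≠ 0 := by
      rw [hf.L_eq hz]
      refine mul_ne_zero (hf.kap_ne hz) ?_
      intro h0
      have : (crs (Φ.F z) z)^2 + (dt z (Φ.F z))^2 = dt (Φ.F z) (Φ.F z) * (z.1 ^ 2 + z.2 ^ 2) := by
        simp only [crs, dt]; ring
      rw [h0, hperp, hb'] at this
      have := dt_self_pos (hf.F_ne hz)
      linarith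
    have hfz : f z = 1 := (hf.one_iff hz.1).2 hb
    have hDz : ∀ u ∈ Icc (-1 : ℝ) 0, z + u • z ∈ diskD := by
      intro u hu
      simp only [diskD, mem_ofPred_eq, Prod.fst_add, Prod.smul_fst, Prod.snd_add, Prod.smul_snd,
        smul_eq_mul]
      have : (z.1 + u * z.1) ^ 2 + (z.2 + u * z.2) ^ 2 = (1 + u)^2 * (z.1 ^ 2 + z.2 ^ 2) := by ring
      rw [this, hb']
      nlinarith [hu.1, hu.2]
    have hpos : 0 < fderivWithin ℝ f (diskD \ {ptO}) z z := by
      rcases lt_or_gt_of_ne hne with h | h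
      swap; · exact h
      exfalso
      obtain ⟨r, hr, m, hm, hi⟩ := hf.locsec_aux hz (v := -z) (by rw [map_neg]; linarith)
      set d := min r 1
      have hd0 : 0 < d := by positivity
      have hDd : z + d • (-z) ∈ diskD := by
        have := hDz (-d) ⟨by linarith [min_le_right r 1], by linarith⟩
        simpa using this
      have := hi 0 d (by simpa using hr.le) (by rw [abs_of_pos hd0]; exact min_le_left _ _)
        (by simpa using hz.1) hDd hd0.le
      simp only [zero_smul, add_zero, sub_zero, hfz] at this
      have h2 := hf.le_one hDd
      have : 0 < m * d := by positivity
      linarith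
    obtain ⟨r, hr, m, hm, hi⟩ := hf.locsec_aux hz hpos
    set d := min r 1
    have hd0 : 0 < d := by positivity
    have hd1 : d ≤ r := min_le_left _ _
    have hd2 : d ≤ 1 := min_le_right _ _
    have hD : ∀ u ∈ Icc (-d) 0, z + u • z ∈ diskD := fun u hu => hDz u ⟨by linarith [hu.1], hu.2⟩
    have hI : ∀ u ∈ Icc (-d) 0, ∀ u' ∈ Icc (-d) 0, u ≤ u' →
        m * (u' - u) ≤ f (z + u' • z) - f (z + u • z) := fun u hu u' hu' h =>
      hi u u' (abs_le.2 ⟨by linarith [hu.1], by linarith [hu.2]⟩)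
        (abs_le.2 ⟨by linarith [hu'.1], by linarith [hu'.2]⟩) (hD u hu) (hD u' hu') h
    obtain ⟨ρ, hρ, hρ'⟩ := hf.locsec_seg (by linarith : -d ≤ 0) hm hD hI
    have h2 := hI (-d) ⟨by linarith, by linarith⟩ 0 ⟨by linarith, by linarith⟩ (by linarith)
    simp only [zero_smul, add_zero, sub_zero, zero_sub, neg_neg] at h2 hρ hρ'
    have hsub : Icc (f z - m * d) (f z + m * d) ∩ Iic 1 ⊆ Icc (f (z + (-d) • z)) (f z) :=
      fun c hc => ⟨by linarith [hc.1.1], by rw [hfz]; exact hc.2⟩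
    exact ⟨m * d, by positivity, ρ, hρ.mono hsub, fun c hc => hρ' c (hsub hc)⟩

end FirstStrongIntegral
end

section
open Filter Topology
variable {Φ : TCFlow} {f : Pt → ℝ}

lemma period_gen {w : Pt} (hw : w ∈ diskD) {r p : ℝ} (hr : 0 < r)
    (hn : ∀ τ, 0 < τ → τ < r → Φ.φ w τ ≠ w) (hp : 0 < p) (hpw : Φ.φ w p = w) :
    ∃ b : ℝ, 0 < b ∧ ∀ s, Φ.φ w s = w ↔ ∃ n : ℤ, s = n * b := by
  let H : AddSubgroup ℝ :=
    { carrier := {s | Φ.φ w s = w}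
      zero_mem' := Φ.φ_zero w hw
      add_mem' := by
        intro a b (ha : Φ.φ w a = w) (hb : Φ.φ w b = w)
        change Φ.φ w (a + b) = w
        rw [← Φ.φ_add w hw, ha, hb]
      neg_mem' := by
        intro a (ha : Φ.φ w a = w)
        exact Φ.φ_neg hw ha }
  have hH : ∀ s, s ∈ H ↔ Φ.φ w s = w := fun s => Iff.rfl
  obtain ⟨b, hb⟩ := AddSubgroup.cyclic_of_isolated_zero (H := H) hr (by
    rw [Set.disjoint_left]
    intro s hs hs'
    exact hn s hs'.1 hs'.2 hs)
  have hmem : ∀ s, s ∈ H ↔ ∃ n : ℤ, s = n * b := by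
    intro s
    rw [hb, AddSubgroup.mem_closure_singleton]
    simp [eq_comm]
  have hb0 : b ≠ 0 := by
    rintro rfl
    obtain ⟨n, h⟩ := (hmem p).1 hpw
    simp at h; linarith
  refine ⟨|b|, abs_pos.2 hb0, fun s => ?_⟩
  rw [← hH, hmem]
  rcases abs_choice b with h | h <;> rw [h]
  constructor <;> rintro ⟨n, rfl⟩ <;> exact ⟨-n, by push_cast; ring⟩

namespace FirstStrongIntegral
variable (hf : FirstStrongIntegral Φ f)
include hf

lemma globsec {c₁ : ℝ} (h0 : 0 < c₁) (h1 : c₁ ≤ 1) :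
    ∃ σ : ℝ → Pt, Continuous σ ∧ (∀ c, σ c ∈ diskD ∧ c₁ ≤ f (σ c)) ∧
      ∀ c ∈ Icc c₁ 1, f (σ c) = c := by
  have hloc : ∀ c : Icc c₁ (1:ℝ), ∃ η > 0, ∃ ρ : ℝ → Pt,
      ContinuousOn ρ (Icc (c - η) (c + η) ∩ Iic 1) ∧
      ∀ c' ∈ Icc (c - η) (c + η) ∩ Iic (1:ℝ), ρ c' ∈ diskD ∧ f (ρ c') = c' := by
    rintro ⟨c, hc⟩
    obtain ⟨z, hz, rfl⟩ := hf.exists_level (c := c) ⟨by linarith [hc.1], hc.2⟩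
    exact hf.locsec (hf.mem_p hz (by linarith [hc.1]))
  choose η hη ρ hρc hρ using hloc
  obtain ⟨t, ht0, htm, ⟨N, htN⟩, htc⟩ := exists_monotone_Icc_subset_open_cover_Icc h1
    (c := fun i : Icc c₁ (1:ℝ) => {x : Icc c₁ (1:ℝ) | (x:ℝ) ∈ Ioo (i - η i) (i + η i)})
    (fun i => isOpen_Ioo.preimage continuous_subtype_val)
    (fun i _ => mem_iUnion.2 ⟨i, by constructor <;> linarith [hη i]⟩)
  have key : ∀ n, ∃ σ : ℝ → Pt, ContinuousOn σ (Icc c₁ (t n)) ∧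
      ∀ c ∈ Icc c₁ (t n : ℝ), σ c ∈ diskD ∧ f (σ c) = c := by
    intro n
    induction n with
    | zero =>
      refine ⟨ρ ⟨c₁, le_refl _, h1⟩, ?_, ?_⟩
      · rw [ht0, Icc_self]; exact continuousOn_singleton _ _
      · rw [ht0, Icc_self]; rintro c rfl
        exact hρ ⟨c, le_refl _, h1⟩ c ⟨⟨by simpa using (hη _).le, by simpa using (hη _).le⟩, h1⟩
    | succ n ih =>
      obtain ⟨σ, hσ, hσ'⟩ := ih
      obtain ⟨i, hi⟩ := htc n
      have hsub : ∀ x ∈ Icc (t n : ℝ) (t (n+1)), x ∈ Icc (i - η i) (i + η i) ∩ Iic (1:ℝ) := by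
        intro x hx
        have hx1 : x ∈ Icc c₁ 1 := ⟨(t n).2.1.trans hx.1, hx.2.trans (t (n+1)).2.2⟩
        have := hi (show (⟨x, hx1⟩ : Icc c₁ (1:ℝ)) ∈ Icc (t n) (t (n+1)) from ⟨hx.1, hx.2⟩)
        exact ⟨⟨this.1.le, this.2.le⟩, hx1.2⟩
      have hle : (t n : ℝ) ≤ t (n+1) := htm (Nat.le_succ n)
      have hA := hσ' (t n) ⟨(t n).2.1, le_refl _⟩
      have hB := hρ i (t n) (hsub _ ⟨le_refl _, hle⟩)
      obtain ⟨s, hs⟩ := hf.conn hB.1 hA.1 (by rw [hA.2, hB.2])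
      refine ⟨fun c => if c ≤ t n then σ c else Φ.φ (ρ i c) s, ?_, ?_⟩
      · have hcc : ContinuousOn (fun c => Φ.φ (ρ i c) s) (Icc (t n : ℝ) (t (n+1))) :=
          Φ.φ_comp ((hρc i).mono hsub) continuousOn_const (fun x hx => (hρ i x (hsub x hx)).1)
        refine ContinuousOn.if ?_ ?_ ?_
        · rintro a ⟨ha, hfr⟩
          have : a = t n := by
            have := frontier_le_subset_eq continuous_id continuous_const hfr
            exact this
          rw [this]; exact hs.symm
        · refine hσ.mono ?_
          rintro x ⟨hx, hx'⟩
          rw [show closure {a : ℝ | a ≤ t n} = Iic (t n : ℝ) from isClosed_Iic.closure_eq] at hx'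
          exact ⟨hx.1, hx'⟩
        · refine hcc.mono ?_
          rintro x ⟨hx, hx'⟩
          have : closure {a : ℝ | ¬ a ≤ t n} ⊆ Ici (t n : ℝ) := by
            refine closure_minimal ?_ isClosed_Ici
            intro y hy; exact (not_le.1 hy).le
          exact ⟨this hx', hx.2⟩
      · intro c hc
        by_cases hcn : c ≤ t n
        · simp only [hcn, if_true]; exact hσ' c ⟨hc.1, hcn⟩
        · simp only [hcn, if_false]
          have := hρ i c (hsub c ⟨(not_le.1 hcn).le, hc.2⟩)
          exact ⟨Φ.φ_mapsTo _ this.1 _, by rw [hf.f_φ this.1, this.2]⟩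
  obtain ⟨σ, hσ, hσ'⟩ := key N
  rw [htN N (le_refl _)] at hσ hσ'
  refine ⟨fun c => σ (projIcc c₁ 1 h1 c), ?_, ?_, ?_⟩
  · exact hσ.comp_continuous (continuous_subtype_val.comp continuous_projIcc) (fun x => Subtype.coe_prop _)
  · intro c
    have := hσ' _ (projIcc c₁ 1 h1 c).2
    exact ⟨this.1, by rw [this.2]; exact (projIcc c₁ 1 h1 c).2.1⟩
  · intro c hc
    simp only [projIcc_of_mem h1 hc]
    exact (hσ' c hc).2

lemma period_fun {σ : ℝ → Pt} (hσ : Continuous σ) (hσp : ∀ c, σ c ∈ diskD \ {ptO}) :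
    ∃ θ : ℝ → ℝ, Continuous θ ∧ (∀ c, 0 < θ c) ∧
      ∀ c s, Φ.φ (σ c) s = σ c ↔ ∃ n : ℤ, s = n * θ c := by
  have hex : ∀ c, ∃ b : ℝ, 0 < b ∧ ∀ s, Φ.φ (σ c) s = σ c ↔ ∃ n : ℤ, s = n * b := by
    intro c
    obtain ⟨p, hp, hpw⟩ := Φ.periodic _ (hσp c).1 (hσp c).2
    obtain ⟨r, hr, hn⟩ := hf.noper (hσp c)
    exact period_gen (hσp c).1 hr (hn _ (hσp c).1 (by simpa using hr)) hp hpw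
  choose θ hθ hθ' using hex
  refine ⟨θ, ?_, hθ, hθ'⟩
  have hper : ∀ c, Φ.φ (σ c) (θ c) = σ c := fun c => (hθ' c _).2 ⟨1, by simp⟩
  have hcont2 : Continuous (fun q : ℝ × ℝ => Φ.φ (σ q.1) q.2) := by
    rw [← continuousOn_univ]
    exact Φ.φ_comp (by fun_prop) (by fun_prop) (fun q _ => (hσp _).1)
  rw [continuous_iff_continuousAt]
  intro c₀
  rw [Metric.continuousAt_iff']
  intro ε hε
  -- upper bound
  have hup : ∀ᶠ c in 𝓝 c₀, θ c < θ c₀ + ε := by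
    obtain ⟨r, hr, hbox⟩ := hf.fbox (hσp c₀) (δ := min ε (θ c₀)) (lt_min hε (hθ c₀))
    have e1 : ∀ᶠ c in 𝓝 c₀, dist (σ c) (σ c₀) < r :=
      (hσ.continuousAt (x := c₀)).eventually (Metric.ball_mem_nhds _ hr)
    have e2 : ∀ᶠ c in 𝓝 c₀, dist (Φ.φ (σ c) (θ c₀)) (σ c₀) < r := by
      have : Continuous (fun c => Φ.φ (σ c) (θ c₀)) := hcont2.comp (by fun_prop : Continuous fun c : ℝ => (c, θ c₀))
      have := (this.continuousAt (x := c₀)).eventually (Metric.ball_mem_nhds _ hr)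
      simpa [hper] using this
    filter_upwards [e1, e2] with c h1 h2
    obtain ⟨τ, hτ, hτe⟩ := hbox _ (Φ.φ_mapsTo _ (hσp c).1 _) _ (hσp c).1 h2 h1 (hf.f_φ (hσp c).1 _)
    rw [Φ.φ_add _ (hσp c).1, hθ'] at hτe
    obtain ⟨n, hn⟩ := hτe
    have hτ1 := hτ.trans_le (min_le_left _ _)
    have hτ2 := hτ.trans_le (min_le_right _ _)
    have hpos : 0 < (n:ℝ) * θ c := by rw [← hn]; linarith [neg_abs_le τ]
    have hn1 : (1:ℝ) ≤ n := by
      have : 0 < (n:ℝ) := pos_of_mul_pos_left hpos (hθ c).le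
      exact_mod_cast this
    nlinarith [le_abs_self τ, hθ c]
  have hlow : ∀ᶠ c in 𝓝 c₀, θ c₀ - ε < θ c := by
    obtain ⟨r, hr, hnp⟩ := hf.noper (hσp c₀)
    have e1 : ∀ᶠ c in 𝓝 c₀, dist (σ c) (σ c₀) < r :=
      (hσ.continuousAt (x := c₀)).eventually (Metric.ball_mem_nhds _ hr)
    have e2 : ∀ᶠ c in 𝓝 c₀, ∀ s ∈ Icc r (θ c₀ - ε), Φ.φ (σ c) s ≠ σ c := by
      refine isCompact_Icc.eventually_forall_of_forall_eventually ?_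
      intro s hs
      have : Φ.φ (σ c₀) s ≠ σ c₀ := by
        intro h
        obtain ⟨n, hn⟩ := (hθ' _ _).1 h
        have hn0 : 0 < (n:ℝ) * θ c₀ := by rw [← hn]; linarith [hs.1]
        have : 0 < (n:ℝ) := pos_of_mul_pos_left hn0 (hθ c₀).le
        have hn1 : (1:ℝ) ≤ n := by exact_mod_cast this
        nlinarith [hs.2, hθ c₀]
      exact (hcont2.continuousAt (x := (c₀, s))).ne_iff_eventually_ne
        ((hσ.comp continuous_fst).continuousAt) |>.1 this
    filter_upwards [e1, e2] with c h1 h2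
    by_contra! h
    refine h2 (θ c) ⟨?_, h⟩ (hper c)
    by_contra! h'
    exact hnp _ (hσp c).1 h1 _ (hθ c) h' (hper c)
  filter_upwards [hup, hlow] with c h1 h2
  rw [Real.dist_eq, abs_lt]; constructor <;> linarith

end FirstStrongIntegral
end

section
open Filter Topology
variable {Φ : TCFlow} {f : Pt → ℝ}

lemma int_shift {K : ℝ → ℝ} (h : ∀ x, K (x + 1) = K x + 1) (n : ℤ) (x : ℝ) : K (x + n) = K x + n := by
  induction n using Int.induction_on with
  | zero => simp
  | succ i ih => 
    have := h (x + i)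
    push_cast at *
    rw [← add_assoc, this, ih]; ring
  | pred i ih =>
    have := h (x + (-i - 1))
    push_cast at *
    rw [show x + (-(i:ℝ) - 1) + 1 = x + -i by ring, ih] at this
    linarith

lemma degree_one {K : ℝ → ℝ} (hK : Continuous K) {n : ℤ} (hn : ∀ x, K (x + 1) = K x + n)
    (hinj : ∀ x y, (∃ m : ℤ, K x = K y + m) → ∃ m : ℤ, x = y + m) (hanti : ¬ StrictAnti K) : n = 1 := by
  have hi : Function.Injective K := by
    intro x y hxy
    -- first, x = y + m
    obtain ⟨m, hm⟩ := hinj x y ⟨0, by simpa using hxy⟩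
    have hn0 : n ≠ 0 := by
      rintro rfl
      have hc1 : K (0 + 1) = K 0 := by simpa using hn 0
      have hper : ContinuousOn K (Icc 0 1) := hK.continuousOn
      -- K attains equal values at x and x + 1/2
      have hg : Continuous (fun x => K (x + 1/2) - K x) := by fun_prop
      have hs : (fun x => K (x + 1/2) - K x) (1/2) = -((fun x => K (x + 1/2) - K x) 0) := by
        have : K (1/2 + 1/2) = K 0 := by
          rw [show (1/2 + 1/2 : ℝ) = 0 + 1 by norm_num]; exact hc1
        simp only [this]; simp
      obtain ⟨u, hu⟩ : ∃ u, K (u + 1/2) - K u = 0 := by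
        rcases le_total 0 ((fun x => K (x + 1/2) - K x) 0) with h | h
        · exact mem_range_of_exists_le_of_exists_ge hg ⟨1/2, by
            beta_reduce at hs h ⊢; linarith⟩ ⟨0, h⟩
        · exact mem_range_of_exists_le_of_exists_ge hg ⟨0, h⟩ ⟨1/2, by
            beta_reduce at hs h ⊢; linarith⟩
      obtain ⟨m, hm⟩ := hinj (u + 1/2) u ⟨0, by push_cast; linarith⟩
      have h2 : (1:ℝ) = ((2 * m : ℤ) : ℝ) := by push_cast; linarith
      have h3 : (1:ℤ) = 2 * m := by exact_mod_cast h2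
      omega
    have hsh : ∀ (m : ℤ) x, K (x + m) = K x + n * m := by
      intro m x
      have := int_shift (K := fun x => K x / n) (fun x => by
        have : (n:ℝ) ≠ 0 := by exact_mod_cast hn0
        simp only [hn]; field_simp) m x
      have hn' : (n:ℝ) ≠ 0 := by exact_mod_cast hn0
      field_simp at this
      linarith
    rw [hm, hsh] at hxy
    have : (n:ℝ) * m = 0 := by linarith
    have h4 : n * m = 0 := by exact_mod_cast this
    rcases mul_eq_zero.1 h4 with h | h
    · exact absurd h hn0
    · rw [hm, h]; simp
  have hmono : StrictMono K := (hK.strictMono_of_inj hi).resolve_right hanti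
  have h1 : K 0 < K (0 + 1) := hmono (by norm_num)
  rw [hn] at h1
  have hnpos : 0 < n := by
    have : (0:ℝ) < n := by linarith
    exact_mod_cast this
  by_contra hne
  have hn2 : 2 ≤ n := by omega
  have hn2' : (2:ℝ) ≤ n := by exact_mod_cast hn2
  obtain ⟨x, hx, hxe⟩ := intermediate_value_Icc (zero_le_one (α := ℝ)) hK.continuousOn
    (show K 0 + 1 ∈ Icc (K 0) (K 1) from ⟨by linarith, by
      have := hn 0; rw [zero_add] at this; rw [this]; linarith⟩)
  obtain ⟨m, hm⟩ := hinj x 0 ⟨1, by simpa using hxe⟩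
  rw [zero_add] at hm
  subst hm
  have a0 : (0:ℤ) ≤ m := by exact_mod_cast hx.1
  have a1 : m ≤ (1:ℤ) := by exact_mod_cast hx.2
  obtain rfl | rfl : m = 0 ∨ m = 1 := by omega
  · simp at hxe
  · have := hn 0
    rw [zero_add] at this
    simp only [Int.cast_one] at hxe
    rw [this] at hxe
    linarith

namespace FirstStrongIntegral
variable (hf : FirstStrongIntegral Φ f)
include hf

lemma not_anti {h : Pt → Pt} {w : Pt} {θ μ : ℝ} {K : ℝ → ℝ} (hw : w ∈ diskD \ {ptO}) (hθ : 0 < θ)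
    (hμ : 0 < μ) (hd : HasDerivAt (fun s => h (Φ.φ w s)) (μ • Φ.F (h w)) 0) (hK : Continuous K)
    (hKe : ∀ x, h (Φ.φ w (x * θ)) = Φ.φ w (K x * θ)) : ¬ StrictAnti K := by
  intro hanti
  have h0 : h w = Φ.φ w (K 0 * θ) := by
    have := hKe 0
    rwa [zero_mul, Φ.φ_zero w hw.1] at this
  have hhw : h w ∈ diskD \ {ptO} := by rw [h0]; exact hf.φ_mem_p hw _
  obtain ⟨r, hr, hm⟩ := hf.smono hhw
  have hm := hm _ hhw.1 (by simpa using hr)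
  have hp : HasDerivAt (fun s => dt (Φ.F (h w)) (h (Φ.φ w s))) (dt (Φ.F (h w)) (μ • Φ.F (h w))) 0 :=
    ((hd_fst hd).const_mul _).add ((hd_snd hd).const_mul _)
  have hpos : 0 < dt (Φ.F (h w)) (μ • Φ.F (h w)) := by
    have : dt (Φ.F (h w)) (μ • Φ.F (h w)) = μ * dt (Φ.F (h w)) (Φ.F (h w)) := by
      simp only [dt, Prod.smul_fst, Prod.smul_snd, smul_eq_mul]; ring
    rw [this]; exact mul_pos hμ (dt_self_pos (hf.F_ne hhw))
  have e1 : ∀ᶠ s in 𝓝[>] (0:ℝ), dt (Φ.F (h w)) (h w) < dt (Φ.F (h w)) (h (Φ.φ w s)) := by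
    have := (hasDerivWithinAt_iff_tendsto_slope' (s := Ioi (0:ℝ)) (by simp)).1
      (hp.hasDerivWithinAt (s := Ioi 0))
    filter_upwards [this.eventually (lt_mem_nhds hpos), self_mem_nhdsWithin] with s hs hs0
    rw [slope_def_field, sub_zero] at hs
    have hs0 : (0:ℝ) < s := hs0
    have := (div_pos_iff_of_pos_right hs0).1 hs
    rw [Φ.φ_zero w hw.1] at this
    linarith
  have e2 : ∀ᶠ s in 𝓝[>] (0:ℝ), |(K (s / θ) - K 0) * θ| < r := by
    have hc : Continuous (fun s => |(K (s / θ) - K 0) * θ|) := by fun_prop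
    have := (hc.continuousAt (x := 0)).eventually (gt_mem_nhds (by simpa using hr))
    exact mem_nhdsWithin_of_mem_nhds this
  obtain ⟨s, h1, h2, hs0⟩ := (e1.and (e2.and self_mem_nhdsWithin)).exists
  have hs0 : (0:ℝ) < s := hs0
  have hneg : (K (s / θ) - K 0) * θ < 0 := by
    have : K (s / θ) < K 0 := hanti (by positivity)
    nlinarith
  have := hm (a := (K (s / θ) - K 0) * θ) (b := 0) ⟨(abs_lt.1 h2).1.le, (abs_lt.1 h2).2.le⟩
    ⟨by linarith, by linarith⟩ hneg
  simp only [Φ.φ_zero _ hhw.1] at this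
  have h3 : Φ.φ (h w) ((K (s / θ) - K 0) * θ) = h (Φ.φ w s) := by
    rw [h0, Φ.φ_add w hw.1, show s = (s/θ) * θ by field_simp, hKe]
    congr 1
    have : s / θ * θ / θ = s / θ := by field_simp
    rw [this]; ring
  rw [h3] at this
  linarith

lemma lift {c₁ : ℝ} (h0 : 0 < c₁) (h1 : c₁ ≤ 1) {h : Pt → Pt}
    (hm : MapsTo h diskD diskD) (hc : ContinuousOn h diskD) (hfh : ∀ z ∈ diskD, f (h z) = f z)
    (hinj : ∀ z ∈ diskD, ∀ w ∈ diskD, f z = c₁ → f w = c₁ → h z = h w → z = w)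
    (hor : ∀ z ∈ diskD, f z = c₁ → ∃ μ : ℝ, 0 < μ ∧ HasDerivAt (fun s => h (Φ.φ z s)) (μ • Φ.F (h z)) 0) :
    ∃ α : Pt → ℝ, ContinuousOn α {z ∈ diskD | c₁ ≤ f z} ∧
      ∀ z ∈ diskD, c₁ ≤ f z → Φ.φ z (α z) = h z := by
  obtain ⟨σ, hσ, hσD, hσf⟩ := hf.globsec h0 h1
  have hσp : ∀ c, σ c ∈ diskD \ {ptO} := fun c => hf.mem_p (hσD c).1 (h0.trans_le (hσD c).2)
  obtain ⟨θ, hθ, hθ0, hθp⟩ := hf.period_fun hσ hσp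
  set A : Set Pt := {z ∈ diskD | c₁ ≤ f z} with hA
  set Q : ℝ × ℝ → Pt := fun q => Φ.φ (σ q.1) (q.2 * θ q.1) with hQ
  have hQc : Continuous Q := by
    rw [← continuousOn_univ]
    exact Φ.φ_comp (by fun_prop) (by fun_prop) (fun q _ => (hσp _).1)
  have hQD : ∀ q, Q q ∈ diskD := fun q => Φ.φ_mapsTo _ (hσp _).1 _
  have hfQ : ∀ q, f (Q q) = f (σ q.1) := fun q => hf.f_φ (hσp _).1 _
  have hQA : ∀ q, Q q ∈ A := fun q => ⟨hQD q, by rw [hfQ]; exact (hσD _).2⟩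
  have hQeq : ∀ c x y, Q (c, x) = Q (c, y) ↔ ∃ m : ℤ, x = y + m := by
    intro c x y
    have hD := (hσp c).1
    have : Q (c, x) = Q (c, y) ↔ Φ.φ (σ c) ((x - y) * θ c) = σ c := by
      simp only [hQ]
      constructor
      · intro h
        have := congrArg (fun p => Φ.φ p (-(y * θ c))) h
        simp only [Φ.φ_add _ hD] at this
        rw [add_neg_cancel, Φ.φ_zero _ hD] at this
        rw [← this]; congr 1; ring
      · intro h
        have := congrArg (fun p => Φ.φ p (y * θ c)) h
        simp only [Φ.φ_add _ hD] at this
        rw [← this]; congr 1; ring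
    rw [this, hθp]
    have h3 := (hθ0 c).ne'
    constructor
    · rintro ⟨n, hn⟩; exact ⟨n, by have := mul_right_cancel₀ h3 hn; linarith⟩
    · rintro ⟨n, hn⟩; exact ⟨n, by rw [hn]; ring⟩
  have hex : ∀ z ∈ A, ∃ x : ℝ, Q (f z, x) = z := by
    intro z hz
    have hfz : f (σ (f z)) = f z := hσf _ ⟨hz.2, hf.le_one hz.1⟩
    obtain ⟨t, ht⟩ := hf.conn (hσp (f z)).1 hz.1 hfz.symm
    refine ⟨t / θ (f z), ?_⟩
    simp only [hQ]
    rw [div_mul_cancel₀ _ (hθ0 _).ne', ht]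
  choose! X hX using hex
  have hfQ' : ∀ c ∈ Icc c₁ 1, ∀ x, f (Q (c, x)) = c := fun c hc x => by rw [hfQ]; exact hσf c hc
  have hXQ : ∀ c ∈ Icc c₁ 1, ∀ x, ∃ m : ℤ, X (Q (c, x)) = x + m := by
    intro c hc x
    have := hX _ (hQA (c, x))
    rw [hfQ' c hc] at this
    exact (hQeq _ _ _).1 this
  -- quotient principle
  have hquot : ∀ {Y : Type} [TopologicalSpace Y] (b : Pt → Y),
      ContinuousOn (fun q => b (Q q)) (Icc c₁ 1 ×ˢ univ) → ContinuousOn b A := by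
    intro Y _ b hb
    let S : Set (ℝ × ℝ) := Icc c₁ 1 ×ˢ Icc 0 1
    have hS : IsCompact S := isCompact_Icc.prod isCompact_Icc
    haveI : CompactSpace S := isCompact_iff_compactSpace.1 hS
    let P : S → A := fun q => ⟨Q q, hQA q⟩
    have hP : Continuous P := (hQc.comp continuous_subtype_val).subtype_mk _
    have hPs : Function.Surjective P := by
      rintro ⟨z, hz⟩
      refine ⟨⟨(f z, Int.fract (X z)), ⟨hz.2, hf.le_one hz.1⟩, Int.fract_nonneg _, (Int.fract_lt_one _).le⟩, ?_⟩
      apply Subtype.ext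
      simp only [P]
      refine Eq.trans ?_ (hX z hz)
      rw [hQeq]
      exact ⟨-⌊X z⌋, by push_cast; rw [← Int.self_sub_floor]; ring⟩
    have hq : IsQuotientMap P := hP.isClosedMap.isQuotientMap hP hPs
    rw [continuousOn_iff_continuous_domRestrict, hq.continuous_iff]
    have := hb.mono (show S ⊆ Icc c₁ 1 ×ˢ univ from fun q hq => ⟨hq.1, mem_univ _⟩)
    rw [continuousOn_iff_continuous_domRestrict] at this
    exact this
  have harg : ContinuousOn (fun z => (X z : AddCircle (1:ℝ))) A := by
    refine hquot _ ?_
    have : ContinuousOn (fun q : ℝ × ℝ => (q.2 : AddCircle (1:ℝ))) (Icc c₁ 1 ×ˢ univ) :=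
      ((AddCircle.continuous_mk' (1:ℝ)).comp continuous_snd).continuousOn
    refine this.congr ?_
    rintro ⟨c, x⟩ ⟨hc, -⟩
    obtain ⟨m, hm⟩ := hXQ c hc x
    simp only [hm]
    have := AddCircle.coe_add_period (1:ℝ) 
    rw [AddCircle.coe_add]
    have : ((m : ℝ) : AddCircle (1:ℝ)) = 0 := by
      rw [AddCircle.coe_eq_zero_iff]; exact ⟨m, by simp⟩
    rw [this, add_zero]
  have hhA : MapsTo h A A := fun z hz => ⟨hm hz.1, by rw [hfh z hz.1]; exact hz.2⟩
  have hGc : Continuous (fun q => (X (h (Q q)) : AddCircle (1:ℝ))) :=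
    (harg.comp (hc.mono fun z hz => hz.1) hhA).comp_continuous hQc hQA
  obtain ⟨K, ⟨-, hK⟩, -⟩ := (AddCircle.isCoveringMap_coe (1:ℝ)).existsUnique_continuousMap_lifts
    ⟨_, hGc⟩ ((0:ℝ), (0:ℝ)) (X (h (Q (0, 0)))) rfl
  have hKG : ∀ q, ∃ m : ℤ, X (h (Q q)) = K q + m := by
    intro q
    have h2 : ((K q : ℝ) : AddCircle (1:ℝ)) = X (h (Q q)) := congrFun hK q
    have h3 : ((X (h (Q q)) - K q : ℝ) : AddCircle (1:ℝ)) = 0 := by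
      rw [AddCircle.coe_sub, h2, sub_self]
    obtain ⟨m, hm⟩ := (AddCircle.coe_eq_zero_iff _).1 h3
    refine ⟨m, ?_⟩
    simp at hm; linarith
  have hKe : ∀ c ∈ Icc c₁ 1, ∀ x, h (Q (c, x)) = Q (c, K (c, x)) := by
    intro c hc x
    have h2 := hX _ (hhA (hQA (c, x)))
    rw [hfh _ (hQD _), hfQ' c hc] at h2
    rw [← h2, hQeq]
    exact hKG _
  have hper : ∀ q : ℝ × ℝ, ∃ m : ℤ, K (q.1, q.2 + 1) - K q = m := by
    intro q
    obtain ⟨m, hm⟩ := hKG q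
    obtain ⟨m', hm'⟩ := hKG (q.1, q.2 + 1)
    have : Q (q.1, q.2 + 1) = Q q := (hQeq _ _ _).2 ⟨1, by simp⟩
    rw [this] at hm'
    exact ⟨m - m', by push_cast; linarith⟩
  choose N hN using hper
  have hNc : Continuous N := by
    rw [Int.isClosedEmbedding_coe_real.isEmbedding.continuous_iff]
    have : (Int.cast ∘ N : ℝ × ℝ → ℝ) = fun q => K (q.1, q.2 + 1) - K q := by
      ext q; exact (hN q).symm
    rw [this]; fun_prop
  have hconst : ∀ q, N q = N (c₁, 0) := fun q => PreconnectedSpace.constant inferInstance hNc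
  have hc1 : c₁ ∈ Icc c₁ 1 := ⟨le_refl _, h1⟩
  have hn1 : N (c₁, 0) = 1 := by
    refine degree_one (K := fun x => K (c₁, x)) (by fun_prop) (fun x => ?_) ?_ ?_
    · have := hN (c₁, x)
      rw [hconst] at this
      simp only at this
      linarith
    · rintro x y ⟨m, hm⟩
      rw [← hQeq c₁]
      refine hinj _ (hQD _) _ (hQD _) (hfQ' _ hc1 _) (hfQ' _ hc1 _) ?_
      rw [hKe _ hc1, hKe _ hc1, hQeq]
      exact ⟨m, hm⟩
    · obtain ⟨μ, hμ, hd⟩ := hor (σ c₁) (hσp _).1 (hσf _ hc1)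
      exact hf.not_anti (K := fun x => K (c₁, x)) (h := h) (hσp c₁) (hθ0 c₁) (μ := μ) hμ hd (by fun_prop) (fun x => hKe c₁ hc1 x)
  have hKs : ∀ c x, K (c, x + 1) = K (c, x) + 1 := by
    intro c x
    have := hN (c, x)
    rw [hconst, hn1] at this
    push_cast at this
    linarith
  have hKn : ∀ c (m : ℤ) x, K (c, x + m) = K (c, x) + m := fun c m x =>
    int_shift (K := fun x => K (c, x)) (hKs c) m x
  refine ⟨fun z => (K (f z, X z) - X z) * θ (f z), ?_, ?_⟩
  · refine ContinuousOn.mul (hquot (fun z => K (f z, X z) - X z) ?_) (hθ.comp_continuousOn (hf.cont.mono fun z hz => hz.1))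
    have : ContinuousOn (fun q : ℝ × ℝ => K q - q.2) (Icc c₁ 1 ×ˢ univ) := by fun_prop
    refine this.congr ?_
    rintro ⟨c, x⟩ ⟨hc, -⟩
    obtain ⟨m, hm⟩ := hXQ c hc x
    simp only [hm, hfQ' c hc, hKn]; ring
  · intro z hz hzc
    have hzA : z ∈ A := ⟨hz, hzc⟩
    have hfc : f z ∈ Icc c₁ 1 := ⟨hzc, hf.le_one hz⟩
    have h2 := hKe (f z) hfc (X z)
    rw [hX z hzA] at h2
    rw [h2]
    have hz' : Φ.φ (σ (f z)) (X z * θ (f z)) = z := hX z hzA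
    have h5 := Φ.φ_add (σ (f z)) (hσp _).1 (X z * θ (f z)) ((K (f z, X z) - X z) * θ (f z))
    rw [hz'] at h5
    beta_reduce
    rw [h5]
    change _ = Φ.φ (σ (f z)) (K (f z, X z) * θ (f z))
    congr 1
    ring

end FirstStrongIntegral
end

section
open Filter Topology
variable {Φ : TCFlow} {f : Pt → ℝ}

lemma det_pt (L : Pt →L[ℝ] Pt) : LinearMap.det (L : Pt →ₗ[ℝ] Pt) = crs (L (1,0)) (L (0,1)) := by
  rw [← LinearMap.det_toMatrix (Module.Basis.finTwoProd ℝ), Matrix.det_fin_two]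
  simp [LinearMap.toMatrix_apply, crs]; ring

lemma crs_map (L : Pt →L[ℝ] Pt) (v w : Pt) :
    crs (L v) (L w) = LinearMap.det (L : Pt →ₗ[ℝ] Pt) * crs v w := by
  have e : ∀ w : Pt, L w = w.1 • L (1,0) + w.2 • L (0,1) := by
    intro w
    have : w = w.1 • ((1:ℝ),(0:ℝ)) + w.2 • ((0:ℝ),(1:ℝ)) := by ext <;> simp
    conv_lhs => rw [this, map_add, map_smul, map_smul]
  rw [det_pt, e v, e w]
  simp [crs]; ring

namespace FirstStrongIntegral
variable (hf : FirstStrongIntegral Φ f)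
include hf
lemma orient {h : Pt → Pt} (hm : MapsTo h diskD diskD) (hfh : ∀ z ∈ diskD, f (h z) = f z)
    {z : Pt} (hz : z ∈ diskD \ {ptO}) (hd : DifferentiableAt ℝ h z)
    (hdet : 0 < LinearMap.det ((fderiv ℝ h z) : Pt →ₗ[ℝ] Pt)) :
    ∃ μ : ℝ, 0 < μ ∧ HasDerivAt (fun s => h (Φ.φ z s)) (μ • Φ.F (h z)) 0 := by
  set L := fderiv ℝ h z
  have hL : HasFDerivAt h L z := hd.hasFDerivAt
  have hmp : MapsTo h (diskD \ {ptO}) (diskD \ {ptO}) := fun w hw =>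
    hf.mem_p (hm hw.1) (by rw [hfh w hw.1]; exact hf.pos hw)
  have hhz := hmp hz
  have h1 : HasFDerivWithinAt (f ∘ h) ((fderivWithin ℝ f (diskD \ {ptO}) (h z)).comp L) (diskD \ {ptO}) z :=
    (hf.hasF hhz).comp z hL.hasFDerivWithinAt hmp
  have h2 : HasFDerivWithinAt (f ∘ h) (fderivWithin ℝ f (diskD \ {ptO}) z) (diskD \ {ptO}) z :=
    (hf.hasF hz).congr (fun w hw => hfh w hw.1) (hfh z hz.1)
  have h3 := (pdisk_udiff z hz).eq h1 h2
  have h4 : ∀ w, kap Φ f (h z) * crs (Φ.F (h z)) (L w) = kap Φ f z * crs (Φ.F z) w := by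
    intro w
    rw [← hf.L_eq hhz, ← hf.L_eq hz, ← h3]; rfl
  set v := Φ.F (h z)
  have hv : v ≠ 0 := hf.F_ne hhz
  have h5 : crs v (L (Φ.F z)) = 0 := by
    have := h4 (Φ.F z)
    have h6 : crs (Φ.F z) (Φ.F z) = 0 := by simp [crs]; ring
    rw [h6, mul_zero] at this
    exact (mul_eq_zero.1 this).resolve_left (hf.kap_ne hhz)
  have hvv := dt_self_pos hv
  have h6 : L (Φ.F z) = (dt (L (Φ.F z)) v / dt v v) • v := by
    have e1 : v.1 * (L (Φ.F z)).2 - v.2 * (L (Φ.F z)).1 = 0 := h5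
    ext
    · simp only [Prod.smul_fst, smul_eq_mul]
      rw [div_mul_eq_mul_div, eq_div_iff hvv.ne']
      simp only [dt]; linear_combination (-v.2) * e1
    · simp only [Prod.smul_snd, smul_eq_mul]
      rw [div_mul_eq_mul_div, eq_div_iff hvv.ne']
      simp only [dt]; linear_combination v.1 * e1
  set μ := dt (L (Φ.F z)) v / dt v v
  refine ⟨μ, ?_, ?_⟩
  · obtain ⟨t, ht⟩ := hf.conn hz.1 hhz.1 (hfh z hz.1)
    have hs := hf.kap_sign hz t
    rw [ht] at hs
    set w : Pt := (-(Φ.F z).2, (Φ.F z).1)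
    have hw : 0 < crs (Φ.F z) w := by
      have := dt_self_pos (hf.F_ne hz)
      simp only [crs, dt, w] at *; linarith
    have h7 := crs_map L (Φ.F z) w
    have h8 : crs (L (Φ.F z)) (L w) = μ * crs v (L w) := by
      rw [h6]; simp [crs]; ring
    have h9 := h4 w
    -- det * crs = μ * crs v (L w);  kap(hz)*crs v (L w) = kap z * crs
    have h10 : kap Φ f (h z) * (LinearMap.det (L : Pt →ₗ[ℝ] Pt)) * crs (Φ.F z) w = μ * kap Φ f z * crs (Φ.F z) w := by
      linear_combination μ * h9 - kap Φ f (h z) * h7 + kap Φ f (h z) * h8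
    have h11 := mul_right_cancel₀ hw.ne' h10
    have h12 : 0 < μ * kap Φ f z ^ 2 := by
      have : 0 < (kap Φ f z * kap Φ f (h z)) * LinearMap.det (L : Pt →ₗ[ℝ] Pt) := mul_pos hs hdet
      calc 0 < _ := this
        _ = _ := by linear_combination kap Φ f z * h11
    exact pos_of_mul_pos_left h12 (sq_nonneg _)
  · rw [← h6]
    have h7 : HasDerivAt (Φ.φ z) (Φ.F z) 0 := by
      simpa [Φ.φ_zero z hz.1] using Φ.φ_deriv z hz.1 0
    have h8 : HasFDerivAt h L (Φ.φ z 0) := by rw [Φ.φ_zero z hz.1]; exact hL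
    exact h8.comp_hasDerivAt (0:ℝ) h7
end FirstStrongIntegral
end

section
open Filter Topology
variable {Φ : TCFlow} {f : Pt → ℝ}

lemma φ_cda (Φ : TCFlow) {z : Pt} (hz : z ∈ odisk) (t : ℝ) :
    ContDiffAt ℝ (⊤ : ℕ∞) (fun p : Pt × ℝ => Φ.φ p.1 p.2) (z, t) :=
  Φ.φ_smooth.contDiffAt (prod_mem_nhds (disk_nhds hz) univ_mem)

namespace FirstStrongIntegral
variable (hf : FirstStrongIntegral Φ f)
include hf
lemma ift {z₀ : Pt} (hz₀ : z₀ ∈ odisk) (hne : z₀ ≠ ptO) {γ : Pt → ℝ} {k : Pt → Pt}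
    (hγ : ContinuousAt γ z₀) (hk : ContDiffAt ℝ (⊤ : ℕ∞) k z₀)
    (he : ∀ᶠ z in 𝓝 z₀, Φ.φ z (γ z) = k z) : ContDiffAt ℝ (⊤ : ℕ∞) γ z₀ := by
  have hzp : z₀ ∈ diskD \ {ptO} := ⟨odisk_sub hz₀, hne⟩
  set a := Φ.F (Φ.φ z₀ (γ z₀)) with ha
  have haa : 0 < dt a a := dt_self_pos (hf.F_ne (hf.φ_mem_p hzp _))
  set G : Pt × ℝ → ℝ := fun v => a.1 * ((Φ.φ v.1 v.2).1 - (k v.1).1) + a.2 * ((Φ.φ v.1 v.2).2 - (k v.1).2) with hG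
  set u : Pt × ℝ := (z₀, γ z₀)
  have hφ := φ_cda Φ hz₀ (γ z₀)
  have hk' : ContDiffAt ℝ (⊤ : ℕ∞) (fun v : Pt × ℝ => k v.1) u := ContDiffAt.comp u hk contDiffAt_fst
  have hGs : ContDiffAt ℝ (⊤ : ℕ∞) G u := by
    refine ContDiffAt.add (contDiffAt_const.mul (ContDiffAt.sub ?_ ?_)) (contDiffAt_const.mul (ContDiffAt.sub ?_ ?_))
    · exact hφ.fst
    · exact hk'.fst
    · exact hφ.snd
    · exact hk'.snd
  have hGu : G u = 0 := by
    have := he.self_of_nhds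
    simp [hG, u, this]
  have hT : (fderiv ℝ G u) (0, 1) = dt a a := by
    have h1 : HasFDerivAt G (fderiv ℝ G u) u := (hGs.differentiableAt (by simp)).hasFDerivAt
    have h2 : HasDerivAt (fun t : ℝ => ((z₀, t) : Pt × ℝ)) (0, 1) (γ z₀) :=
      (hasDerivAt_const _ _).prodMk (hasDerivAt_id _)
    have h3 := h1.comp_hasDerivAt (γ z₀) h2
    have h4 := Φ.φ_deriv z₀ hzp.1 (γ z₀)
    have h5 : HasDerivAt (G ∘ fun t : ℝ => ((z₀, t) : Pt × ℝ)) (a.1 * a.1 + a.2 * a.2) (γ z₀) := by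
      have d1 : HasDerivAt (fun t => (Φ.φ z₀ t).1) a.1 (γ z₀) :=
        (ContinuousLinearMap.fst ℝ ℝ ℝ).hasFDerivAt.comp_hasDerivAt _ h4
      have d2 : HasDerivAt (fun t => (Φ.φ z₀ t).2) a.2 (γ z₀) :=
        (ContinuousLinearMap.snd ℝ ℝ ℝ).hasFDerivAt.comp_hasDerivAt _ h4
      have e1 := ((d1.sub_const (k z₀).1).const_mul a.1)
      have e2 := ((d2.sub_const (k z₀).2).const_mul a.2)
      exact e1.add e2
    exact h3.unique h5
  have hinv : (fderiv ℝ G u ∘L .inr ℝ Pt ℝ).IsInvertible := by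
    have hT' : ∀ x : ℝ, (fderiv ℝ G u ∘L .inr ℝ Pt ℝ) x = x * dt a a := by
      intro x
      rw [← hT]
      have : x = x • (1:ℝ) := by simp
      conv_lhs => rw [this, map_smul]
      simp
    refine ContinuousLinearMap.IsInvertible.of_inverse (g := (dt a a)⁻¹ • ContinuousLinearMap.id ℝ ℝ) ?_ ?_
    · apply ContinuousLinearMap.ext; intro x
      rw [ContinuousLinearMap.comp_apply, hT']
      simp; field_simp
    · apply ContinuousLinearMap.ext; intro x
      rw [ContinuousLinearMap.comp_apply, hT']
      simp; field_simp
  have h1 := hGs.eventually_apply_eq_iff_implicitFunction (by simp) hinv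
  have h2 := hGs.contDiffAt_implicitFunction (by simp) hinv
  have h3 : Tendsto (fun z => (z, γ z)) (𝓝 z₀) (𝓝 u) := by
    have : ContinuousAt (fun z => (z, γ z)) z₀ := continuousAt_id.prodMk hγ
    exact this
  refine h2.congr_of_eventuallyEq ?_
  filter_upwards [h3.eventually h1, he] with z hz hz'
  refine (hz.1 ?_).symm
  rw [hGu]; simp [hG, hz']

omit hf in
lemma orb_shift {γ : Pt → ℝ} {A : Set Pt} (hA : IsCompact A) (hγ : ContinuousOn γ A) {z : Pt} (hz : z ∈ diskD)
    (hzA : orb Φ z ⊆ A) : (fun z => Φ.φ z (γ z)) '' orb Φ z = orb Φ z := by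
  obtain ⟨M, hM⟩ := hA.exists_bound_of_continuousOn hγ
  have key : ∀ s, Φ.φ (Φ.φ z s) (γ (Φ.φ z s)) = Φ.φ z (s + γ (Φ.φ z s)) := fun s => Φ.φ_add z hz _ _
  ext w; constructor
  · rintro ⟨_, ⟨s, rfl⟩, rfl⟩
    exact ⟨_, (key s).symm⟩
  · rintro ⟨u, rfl⟩
    have hc : Continuous (fun s => s + γ (Φ.φ z s)) :=
      continuous_id.add (hγ.comp_continuous (Φ.φ_cont' hz) (fun s => hzA ⟨s, rfl⟩))
    have hb : ∀ s, |γ (Φ.φ z s)| ≤ M := fun s => hM _ (hzA ⟨s, rfl⟩)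
    obtain ⟨s, hs⟩ := mem_range_of_exists_le_of_exists_ge (c := u) hc
      ⟨u - M, by have := abs_le.1 (hb (u - M)); linarith⟩
      ⟨u + M, by have := abs_le.1 (hb (u + M)); linarith⟩
    refine ⟨Φ.φ z s, ⟨s, rfl⟩, ?_⟩
    beta_reduce at hs ⊢
    rw [key, hs]

omit hf in
lemma shift_mem {γ : Pt → ℝ} (hγ : ContinuousOn γ diskD) (h0 : ∀ᶠ z in 𝓝 ptO, γ z = 0)
    (hs : ContDiffOn ℝ (⊤ : ℕ∞) (fun z => Φ.φ z (γ z)) diskD) : EplMem Φ (fun z => Φ.φ z (γ z)) := by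
  have hev : (fun z => Φ.φ z (γ z)) =ᶠ[𝓝 ptO] id := by
    filter_upwards [h0, disk_nhds ptO_odisk] with z hz hzd
    rw [hz, Φ.φ_zero z hzd]; rfl
  refine ⟨⟨fun z hz => Φ.φ_mapsTo z hz _, hs, ?_, ?_⟩, ?_⟩
  · intro z hz
    exact orb_shift disk_compact hγ hz (orb_sub hz)
  · obtain ⟨U, hU, hUo, hUO⟩ := eventually_nhds_iff.1 (hev.and (odisk_open.mem_nhds ptO_odisk))
    have hUd : U ⊆ diskD := fun z hz => odisk_sub (hU z hz).2
    have hid : EqOn id (fun z => Φ.φ z (γ z)) U := fun z hz => (hU z hz).1.symm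
    refine ⟨U, U, hUo, hUo, hUO, hUO, hUd, hUd, (bijOn_id U).congr hid, id, contDiffOn_id, fun z hz => ?_⟩
    exact (hU z hz).1
  · rw [hev.fderiv_eq]
    have : ((fderiv ℝ id ptO : Pt →L[ℝ] Pt) : Pt →ₗ[ℝ] Pt) = LinearMap.id := by
      rw [fderiv_id]; rfl
    rw [this, LinearMap.det_id]; norm_num

omit hf in
lemma homot {γ : Pt → ℝ} {k₀ : Pt → Pt} (hk₀ : ContDiffOn ℝ (⊤ : ℕ∞) k₀ diskD)
    (hk : ∀ z ∈ diskD, Φ.φ z (γ z) = k₀ z) (hγ : ContinuousOn γ diskD)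
    (hγs : ∀ z ∈ odisk, ContDiffAt ℝ (⊤ : ℕ∞) γ z) (h0 : ∀ᶠ z in 𝓝 ptO, γ z = 0) :
    ∃ H : ℝ → Pt → Pt, ContinuousOn (fun p : ℝ × Pt => H p.1 p.2) (Icc (0 : ℝ) 1 ×ˢ diskD) ∧
      (∀ t ∈ Icc (0:ℝ) 1, EplMem Φ (H t)) ∧ (∀ z ∈ diskD, H 0 z = k₀ z) ∧ ∀ z ∈ diskD, H 1 z = z := by
  have hsc : ∀ t ∈ Icc (0:ℝ) 1, ∀ z ∈ diskD, (1 - t/2) • z ∈ diskD := by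
    intro t ht z hz
    have h1 : 0 ≤ 1 - t/2 := by linarith [ht.2]
    have h2 : 1 - t/2 ≤ 1 := by linarith [ht.1]
    have := disk_convex hz (odisk_sub ptO_odisk) h1 (sub_nonneg.2 h2) (by ring)
    have e : ptO = (0 : Pt) := rfl
    rwa [e, smul_zero, add_zero] at this
  have hsc' : ∀ t ∈ Icc (0:ℝ) 1, 0 < t → ∀ z ∈ diskD, (1 - t/2) • z ∈ odisk := by
    intro t ht h0 z hz
    have hz' : z.1 ^ 2 + z.2 ^ 2 ≤ 1 := hz
    change ((1 - t/2) * z.1)^2 + ((1 - t/2) * z.2)^2 < 1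
    have h1 : (1 - t/2)^2 < 1 := by nlinarith [ht.2]
    nlinarith [sq_nonneg (1 - t/2), sq_nonneg z.1, sq_nonneg z.2]
  refine ⟨fun t z => Φ.φ z ((1 - t) * γ ((1 - t/2) • z)), ?_, ?_, ?_, ?_⟩
  · refine Φ.φ_comp continuousOn_snd ?_ (fun p hp => hp.2)
    refine ContinuousOn.mul (by fun_prop) (hγ.comp (f := fun p : ℝ × Pt => (1 - p.1/2) • p.2) (by fun_prop) ?_)
    intro p hp; exact hsc _ hp.1 _ hp.2
  · intro t ht
    refine shift_mem (γ := fun z => (1 - t) * γ ((1 - t/2) • z)) ?_ ?_ ?_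
    · exact continuousOn_const.mul (hγ.comp (f := fun z : Pt => (1 - t/2) • z) (by fun_prop) (hsc t ht))
    · have : Tendsto (fun z : Pt => (1 - t/2) • z) (𝓝 ptO) (𝓝 ptO) := by
        have : Continuous (fun z : Pt => (1 - t/2) • z) := by fun_prop
        have := this.tendsto ptO
        have e : ptO = (0 : Pt) := rfl
        rwa [e, smul_zero] at this
      filter_upwards [this.eventually h0] with z hz
      rw [hz, mul_zero]
    · rcases ht.1.eq_or_lt with rfl | htp
      · refine hk₀.congr fun z hz => ?_
        rw [← hk z hz]; simp
      · have h1 : ContDiffOn ℝ (⊤ : ℕ∞) (fun z => (1 - t) * γ ((1 - t/2) • z)) diskD := by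
          intro z hz
          have h2 : ContDiffAt ℝ (⊤ : ℕ∞) (fun z => γ ((1 - t/2) • z)) z :=
            ContDiffAt.comp z (hγs _ (hsc' t ht htp z hz)) (contDiffAt_id.const_smul (1 - t/2))
          exact (contDiffAt_const.mul h2).contDiffWithinAt
        exact Φ.φ_smooth.comp (contDiffOn_id.prodMk h1) (fun z hz => ⟨hz, mem_univ _⟩)
  · intro z hz; rw [← hk z hz]; simp
  · intro z hz; simp [Φ.φ_zero z hz]
end FirstStrongIntegral
end

section
open Filter Topology
variable {Φ : TCFlow} {f : Pt → ℝ}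
namespace FirstStrongIntegral
variable (hf : FirstStrongIntegral Φ f)
include hf

lemma levels {W : Set Pt} (hW : W ∈ 𝓝 ptO) : ∃ c₀, 0 < c₀ ∧ c₀ < 1 ∧ ∀ z ∈ diskD, f z ≤ c₀ → z ∈ W := by
  have hK : IsCompact (diskD \ interior W) := disk_compact.diff isOpen_interior
  rcases (diskD \ interior W).eq_empty_or_nonempty with he | hne
  · refine ⟨1/2, by norm_num, by norm_num, fun z hz _ => ?_⟩
    by_contra h
    have : z ∈ diskD \ interior W := ⟨hz, fun h' => h (interior_subset h')⟩
    rw [he] at this; exact this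
  · obtain ⟨x, hx, hmin⟩ := hK.exists_isMinOn hne (hf.cont.mono sdiff_subset)
    have hpos : 0 < f x := hf.pos ⟨hx.1, fun h => hx.2 (by rw [mem_singleton_iff.1 h]; exact mem_interior_iff_mem_nhds.2 hW)⟩
    have := hf.le_one hx.1
    refine ⟨f x / 2, by linarith, by linarith, fun z hz hzf => ?_⟩
    by_contra h
    have h2 : z ∈ diskD \ interior W := ⟨hz, fun h' => h (interior_subset h')⟩
    have : f x ≤ f z := hmin h2
    linarith

lemma clev {T : Set ℝ} (hT : IsClosed T) : IsClosed (diskD ∩ f ⁻¹' T) :=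
  hf.cont.preimage_isClosed_of_isClosed disk_closed hT

lemma glue {X : Type*} [TopologicalSpace X] {γ : Pt → X} {S T : Set ℝ} (hS : IsClosed S) (hT : IsClosed T)
    (h1 : ContinuousOn γ (diskD ∩ f ⁻¹' S)) (h2 : ContinuousOn γ (diskD ∩ f ⁻¹' T)) :
    ContinuousOn γ (diskD ∩ f ⁻¹' (S ∪ T)) := by
  rw [preimage_union, inter_union_distrib_left]
  exact h1.union_of_isClosed h2 (hf.clev hS) (hf.clev hT)

lemma fcont {z : Pt} (hz : z ∈ odisk) : ContinuousAt f z := hf.cont.continuousAt (disk_nhds hz)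

lemma fsm {z : Pt} (hz : z ∈ odisk) (h : 0 < f z) : ContDiffAt ℝ (⊤ : ℕ∞) f z :=
  hf.smooth.contDiffAt (by
    rw [sdiff_eq]
    exact inter_mem (disk_nhds hz) (isOpen_compl_singleton.mem_nhds (hf.mem_p (odisk_sub hz) h).2))

lemma finish {c₂ : ℝ} (hc : 0 < c₂) {p : Pt → Pt} {γ : Pt → ℝ}
    (hp : ContDiffOn ℝ (⊤ : ℕ∞) p diskD) (hγ : ContinuousOn γ (diskD ∩ f ⁻¹' (Ici c₂)))
    (h0 : ∀ z ∈ diskD, f z = c₂ → γ z = 0) (hφ : ∀ z ∈ diskD, c₂ ≤ f z → Φ.φ z (γ z) = p z)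
    (hpi : ∀ z ∈ diskD, f z ≤ c₂ → p z = z) :
    ∃ H : ℝ → Pt → Pt, ContinuousOn (fun p : ℝ × Pt => H p.1 p.2) (Icc (0 : ℝ) 1 ×ˢ diskD) ∧
      (∀ t ∈ Icc (0:ℝ) 1, EplMem Φ (H t)) ∧ (∀ z ∈ diskD, H 0 z = p z) ∧ ∀ z ∈ diskD, H 1 z = z := by
  classical
  set δ : Pt → ℝ := fun z => if f z ≤ c₂ then 0 else γ z with hδ
  have d1 : ∀ z, f z ≤ c₂ → δ z = 0 := fun z hz => if_pos hz
  have d2 : ∀ z ∈ diskD, c₂ ≤ f z → δ z = γ z := by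
    intro z hz hzc
    rcases hzc.eq_or_lt with h | h
    · rw [d1 z h.ge, h0 z hz h.symm]
    · exact if_neg (not_le.2 h)
  have hδφ : ∀ z ∈ diskD, Φ.φ z (δ z) = p z := by
    intro z hz
    rcases le_total (f z) c₂ with h | h
    · rw [d1 z h, hpi z hz h, Φ.φ_zero z hz]
    · rw [d2 z hz h, hφ z hz h]
  have hδc : ContinuousOn δ diskD := by
    have := hf.glue (γ := δ) (isClosed_Iic (a := c₂)) (isClosed_Ici (a := c₂))
      (continuousOn_const.congr (fun z hz => d1 z hz.2)) (hγ.congr fun z hz => d2 z hz.1 hz.2)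
    rwa [Iic_union_Ici, preimage_univ, inter_univ] at this
  have hz0 : ∀ z ∈ odisk, f z < c₂ → ∀ᶠ w in 𝓝 z, δ w = 0 := by
    intro z hz hzc
    filter_upwards [(hf.fcont hz).eventually (gt_mem_nhds hzc)] with w hw
    exact d1 w (le_of_lt hw)
  refine homot hp hδφ hδc ?_ (hz0 _ ptO_odisk (by rw [(hf.zero_iff (odisk_sub ptO_odisk)).2 rfl]; exact hc))
  intro z hz
  rcases lt_or_ge (f z) c₂ with h | h
  · exact (contDiffAt_const (c := (0:ℝ))).congr_of_eventuallyEq (hz0 z hz h)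
  · refine hf.ift (k := p) hz (hf.mem_p (odisk_sub hz) (hc.trans_le h)).2 (hδc.continuousAt (disk_nhds hz)) (hp.contDiffAt (disk_nhds hz)) ?_
    filter_upwards [disk_nhds hz] with w hw
    exact hδφ w hw

/-- local normal data near the centre -/
lemma local_data {h : Pt → Pt} (hh : EplMem Φ h) : ∃ (c₀ : ℝ) (k : Pt → Pt), 0 < c₀ ∧ c₀ < 1 ∧
    ∀ z ∈ diskD, f z ≤ c₀ → k z ∈ diskD ∧ f (k z) = f z ∧ h (k z) = z ∧ k (h z) = z ∧ z ∈ odisk ∧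
      ContDiffAt ℝ (⊤ : ℕ∞) k z ∧ 0 < LinearMap.det ((fderiv ℝ h z) : Pt →ₗ[ℝ] Pt) := by
  obtain ⟨hE, hdet⟩ := hh
  have hE' := hE
  obtain ⟨hm, hs, -, U, V, hU, hV, hOU, hOV, hUD, hVD, hb, k, hk, hkh⟩ := hE
  have hsO : ContDiffAt ℝ (⊤ : ℕ∞) h ptO := hs.contDiffAt (disk_nhds ptO_odisk)
  have hfc : ContinuousAt (fderiv ℝ h) ptO :=
    (hsO.fderiv_right (m := 0) (by simp)).continuousAt
  have hdc : ContinuousAt (fun z => LinearMap.det ((fderiv ℝ h z) : Pt →ₗ[ℝ] Pt)) ptO := by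
    simp only [det_pt, crs]
    have h1 := hfc.clm_apply (continuousAt_const (y := ((1:ℝ),(0:ℝ))))
    have h2 := hfc.clm_apply (continuousAt_const (y := ((0:ℝ),(1:ℝ))))
    exact (h1.fst.mul h2.snd).sub (h1.snd.mul h2.fst)
  have hW : U ∩ V ∩ odisk ∩ {z | 0 < LinearMap.det ((fderiv ℝ h z) : Pt →ₗ[ℝ] Pt)} ∈ 𝓝 ptO :=
    inter_mem (inter_mem (inter_mem (hU.mem_nhds hOU) (hV.mem_nhds hOV)) (odisk_open.mem_nhds ptO_odisk))
      (hdc.eventually (lt_mem_nhds hdet))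
  obtain ⟨c₀, h0, h1, hc⟩ := hf.levels hW
  refine ⟨c₀, k, h0, h1, fun z hz hzc => ?_⟩
  obtain ⟨⟨⟨hzU, hzV⟩, hzo⟩, hzd⟩ := hc z hz hzc
  obtain ⟨u, hu, rfl⟩ := hb.surjOn hzV
  have hfu := hf.f_h hE' (hUD hu)
  refine ⟨by rw [hkh u hu]; exact hUD hu, by rw [hkh u hu, hfu], by rw [hkh u hu], hkh _ hzU, hzo,
    hk.contDiffAt (hV.mem_nhds hzV), hzd⟩

end FirstStrongIntegral
end

section
open Filter Topology
variable {Φ : TCFlow} {f : Pt → ℝ}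

theorem main_aux
    (Φ : TCFlow) (f : Pt → ℝ) (hf : FirstStrongIntegral Φ f)
    (h : Pt → Pt) (hh : EplMem Φ h) :
    ∃ g : Pt → Pt, EplMem Φ g ∧
      ∃ H₁ H₂ : ℝ → Pt → Pt,
        ContinuousOn (fun p : ℝ × Pt => H₁ p.1 p.2) (Icc (0 : ℝ) 1 ×ˢ diskD) ∧
        ContinuousOn (fun p : ℝ × Pt => H₂ p.1 p.2) (Icc (0 : ℝ) 1 ×ˢ diskD) ∧
        (∀ t ∈ Icc (0 : ℝ) 1, EplMem Φ (H₁ t) ∧ EplMem Φ (H₂ t)) ∧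
        (∀ z ∈ diskD, H₁ 0 z = g (h z)) ∧
        (∀ z ∈ diskD, H₁ 1 z = z) ∧
        (∀ z ∈ diskD, H₂ 0 z = h (g z)) ∧
        (∀ z ∈ diskD, H₂ 1 z = z) := by
  classical
  obtain ⟨c₀, k, hc0, hc01, hk⟩ := hf.local_data hh
  have hm : MapsTo h diskD diskD := hh.1.1
  have hs : ContDiffOn ℝ (⊤ : ℕ∞) h diskD := hh.1.2.1
  have hfh : ∀ z ∈ diskD, f (h z) = f z := fun z hz => hf.f_h hh.1 hz
  have hsat : ∀ z ∈ odisk, ContDiffAt ℝ (⊤ : ℕ∞) h z := fun z hz => hs.contDiffAt (disk_nhds hz)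
  obtain ⟨c₁, hc1⟩ : ∃ c₁, c₁ = c₀ / 4 := ⟨_, rfl⟩
  obtain ⟨c₂, hc2⟩ : ∃ c₂, c₂ = c₀ / 2 := ⟨_, rfl⟩
  obtain ⟨c₃, hc3⟩ : ∃ c₃, c₃ = 3 * c₀ / 4 := ⟨_, rfl⟩
  have h1p : 0 < c₁ := by linarith
  have h12 : c₁ < c₂ := by linarith
  have h23 : c₂ < c₃ := by linarith
  have h30 : c₃ < c₀ := by linarith
  obtain ⟨α, hα, hαe⟩ := hf.lift h1p (by linarith) hm hs.continuousOn hfh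
    (by
      intro z hz w hw hzc hwc he
      rw [← (hk z hz (by linarith)).2.2.2.1, he, (hk w hw (by linarith)).2.2.2.1])
    (by
      intro z hz hzc
      have := hk z hz (by linarith)
      exact hf.orient hm hfh (hf.mem_p hz (by linarith)) ((hsat z this.2.2.2.2.1).differentiableAt (by simp)) this.2.2.2.2.2.2)
  have hαs : ∀ z ∈ odisk, c₁ < f z → ContDiffAt ℝ (⊤ : ℕ∞) α z := by
    intro z hz hzc
    have hev : ∀ᶠ w in 𝓝 z, w ∈ diskD ∧ c₁ ≤ f w := by
      filter_upwards [disk_nhds hz, (hf.fcont hz).eventually (lt_mem_nhds hzc)] with w hw hw'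
      exact ⟨hw, hw'.le⟩
    refine hf.ift (k := h) hz (hf.mem_p (odisk_sub hz) (by linarith)).2 (hα.continuousAt hev) (hsat z hz) ?_
    filter_upwards [hev] with w hw
    exact hαe w hw.1 hw.2
  set χ : ℝ → ℝ := fun c => Real.smoothTransition ((c₃ - c) / (c₃ - c₂)) with hχ
  have h32 : 0 < c₃ - c₂ := by linarith
  have χ1 : ∀ c ≤ c₂, χ c = 1 := fun c hc =>
    Real.smoothTransition.one_of_one_le (by rw [one_le_div h32]; linarith)
  have χ0 : ∀ c, c₃ ≤ c → χ c = 0 := fun c hc =>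
    Real.smoothTransition.zero_of_nonpos (div_nonpos_of_nonpos_of_nonneg (by linarith) h32.le)
  have χs : ContDiff ℝ (⊤ : ℕ∞) χ := by
    refine Real.smoothTransition.contDiff.comp ?_
    fun_prop
  set B : Pt → ℝ := fun z => χ (f z) * (-α (k z)) with hB
  have B0 : ∀ z, c₃ ≤ f z → B z = 0 := fun z hz => by simp [hB, χ0 _ hz]
  have B1 : ∀ z, f z ≤ c₂ → B z = -α (k z) := fun z hz => by simp [hB, χ1 _ hz]
  have hkc : ContinuousOn k (diskD ∩ f ⁻¹' (Icc c₁ c₀)) := fun z hz =>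
    (hk z hz.1 hz.2.2).2.2.2.2.2.1.continuousAt.continuousWithinAt
  have hBc : ContinuousOn B (diskD ∩ f ⁻¹' (Ici c₁)) := by
    have e : Ici c₁ = Icc c₁ c₀ ∪ Ici c₃ := by
      ext x; simp only [mem_Ici, mem_union, mem_Icc]
      constructor
      · intro hx
        rcases le_total x c₀ with h | h
        · exact Or.inl ⟨hx, h⟩
        · exact Or.inr (by linarith)
      · rintro (h | h)
        · exact h.1
        · linarith
    rw [e]
    refine hf.glue isClosed_Icc isClosed_Ici ?_ (continuousOn_const.congr (fun z hz => B0 z hz.2))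
    refine ContinuousOn.mul (χs.continuous.comp_continuousOn (hf.cont.mono inter_subset_left)) (ContinuousOn.neg ?_)
    refine hα.comp hkc ?_
    intro z hz
    have := hk z hz.1 hz.2.2
    exact ⟨this.1, by rw [this.2.1]; exact hz.2.1⟩
  have hBs : ∀ z ∈ odisk, c₁ < f z → f z < c₀ → ContDiffAt ℝ (⊤ : ℕ∞) B z := by
    intro z hz hz1 hz0
    have h4 := hk z (odisk_sub hz) hz0.le
    have h5 := hk (k z) h4.1 (by rw [h4.2.1]; exact hz0.le)
    refine ContDiffAt.mul (ContDiffAt.comp z χs.contDiffAt (hf.fsm hz (by linarith))) (ContDiffAt.neg ?_)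
    exact ContDiffAt.comp z (hαs (k z) h5.2.2.2.2.1 (by rw [h4.2.1]; exact hz1)) h4.2.2.2.2.2.1
  set g : Pt → Pt := fun z => if f z ≤ c₂ then k z else Φ.φ z (B z) with hg
  have g1 : ∀ z, f z ≤ c₂ → g z = k z := fun z hz => if_pos hz
  have g2 : ∀ z ∈ diskD, c₁ ≤ f z → g z = Φ.φ z (B z) := by
    intro z hz hz1
    rcases le_or_gt (f z) c₂ with hz2 | hz2
    · rw [g1 z hz2, B1 z hz2]
      have h4 := hk z hz (by linarith)
      refine (Φ.φ_neg h4.1 ?_).symm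
      rw [hαe _ h4.1 (by rw [h4.2.1]; exact hz1), h4.2.2.1]
    · exact if_neg (not_le.2 hz2)
  have g3 : ∀ z ∈ diskD, c₃ ≤ f z → g z = z := by
    intro z hz hz3
    rw [g2 z hz (by linarith), B0 z hz3, Φ.φ_zero z hz]
  have gD : ∀ z ∈ diskD, g z ∈ diskD ∧ f (g z) = f z := by
    intro z hz
    rcases le_total (f z) c₂ with hz2 | hz2
    · have h4 := hk z hz (by linarith)
      rw [g1 z hz2]; exact ⟨h4.1, h4.2.1⟩
    · rw [g2 z hz (by linarith)]
      exact ⟨Φ.φ_mapsTo z hz _, hf.f_φ hz _⟩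
  have gs : ContDiffOn ℝ (⊤ : ℕ∞) g diskD := by
    intro z hz
    rcases lt_or_ge (f z) c₂ with hz2 | hz2
    · have h4 := hk z hz (by linarith)
      have hzo := h4.2.2.2.2.1
      refine (h4.2.2.2.2.2.1.congr_of_eventuallyEq ?_).contDiffWithinAt
      filter_upwards [(hf.fcont hzo).eventually (gt_mem_nhds hz2)] with w hw
      exact g1 w (le_of_lt hw)
    rcases lt_or_ge (f z) c₀ with hz0 | hz0
    · have h4 := hk z hz (by linarith)
      have hzo := h4.2.2.2.2.1
      have h5 : ContDiffAt ℝ (⊤ : ℕ∞) (fun w => Φ.φ w (B w)) z :=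
        ContDiffAt.comp (g := fun p : Pt × ℝ => Φ.φ p.1 p.2) (f := fun w => (w, B w)) z (φ_cda Φ hzo (B z)) (contDiffAt_id.prodMk (hBs z hzo (by linarith) hz0))
      refine (h5.congr_of_eventuallyEq ?_).contDiffWithinAt
      have h6 : c₁ < f z := by linarith
      filter_upwards [disk_nhds hzo, (hf.fcont hzo).eventually (lt_mem_nhds h6)] with w hw hw'
      exact g2 w hw (le_of_lt hw')
    · refine ContDiffWithinAt.congr_of_eventuallyEq (contDiffWithinAt_id) ?_ (g3 z hz (by linarith))
      have h6 : c₃ < f z := by linarith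
      filter_upwards [self_mem_nhdsWithin, (hf.cont z hz).eventually (lt_mem_nhds h6)] with w hw hw'
      exact g3 w hw (le_of_lt hw')
  have hgh : ∀ z ∈ diskD, f z ≤ c₂ → g (h z) = z := by
    intro z hz hz2
    rw [g1 _ (by rw [hfh z hz]; exact hz2)]
    exact (hk z hz (by linarith)).2.2.2.1
  have hhg : ∀ z ∈ diskD, f z ≤ c₂ → h (g z) = z := by
    intro z hz hz2
    rw [g1 _ hz2]
    exact (hk z hz (by linarith)).2.2.1
  have hOd : ptO ∈ diskD := odisk_sub ptO_odisk
  have fO : f ptO = 0 := (hf.zero_iff hOd).2 rfl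
  have hO : h ptO = ptO := (hf.zero_iff (hm hOd)).1 (by rw [hfh _ hOd, fO])
  have hGE : EplMem Φ g := by
    refine ⟨⟨fun z hz => (gD z hz).1, gs, ?_, ?_⟩, ?_⟩
    · intro z hz
      rcases le_total (f z) c₂ with hz2 | hz2
      · ext w
        rw [hf.orb_iff hz]
        constructor
        · rintro ⟨u, hu, rfl⟩
          obtain ⟨hu1, hu2⟩ := (hf.orb_iff hz).1 hu
          exact ⟨(gD u hu1).1, by rw [(gD u hu1).2, hu2]⟩
        · rintro ⟨hw, hwz⟩
          exact ⟨h w, (hf.orb_iff hz).2 ⟨hm hw, by rw [hfh w hw, hwz]⟩, hgh w hw (by linarith)⟩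
      · have hsub : orb Φ z ⊆ diskD ∩ f ⁻¹' (Ici c₁) := by
          intro w hw
          obtain ⟨hw1, hw2⟩ := (hf.orb_iff hz).1 hw
          refine ⟨hw1, ?_⟩
          change c₁ ≤ f w
          linarith
        conv_rhs => rw [← FirstStrongIntegral.orb_shift (disk_compact.of_isClosed_subset (hf.clev isClosed_Ici) inter_subset_left) hBc hz hsub]
        exact image_congr (fun w hw => g2 w (hsub hw).1 (hsub hw).2)
    · have hUo : IsOpen (odisk ∩ f ⁻¹' (Iio c₂)) :=
        (hf.cont.mono odisk_sub).isOpen_inter_preimage odisk_open isOpen_Iio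
      have hsub : odisk ∩ f ⁻¹' (Iio c₂) ⊆ diskD := fun z hz => odisk_sub hz.1
      have hmem : ptO ∈ odisk ∩ f ⁻¹' (Iio c₂) := ⟨ptO_odisk, by
        change f ptO < c₂
        rw [fO]; linarith⟩
      refine ⟨_, _, hUo, hUo, hmem, hmem, hsub, hsub, ⟨?_, ?_, ?_⟩, h, hs.mono hsub, ?_⟩
      · intro z hz
        obtain ⟨h4, h5⟩ := gD z (hsub hz)
        have hz2 : f z < c₂ := hz.2
        refine ⟨(hk (g z) h4 (by linarith)).2.2.2.2.1, ?_⟩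
        change f (g z) < c₂
        linarith
      · intro z hz w hw he
        rw [← hhg z (hsub hz) (le_of_lt hz.2), he, hhg w (hsub hw) (le_of_lt hw.2)]
      · intro z hz
        have hz2 : f z < c₂ := hz.2
        have h4 := hfh z (hsub hz)
        refine ⟨h z, ⟨(hk (h z) (hm (hsub hz)) (by linarith)).2.2.2.2.1, ?_⟩, hgh z (hsub hz) hz2.le⟩
        change f (h z) < c₂
        linarith
      · intro z hz
        exact hhg z (hsub hz) (le_of_lt hz.2)
    · have e : g ∘ h =ᶠ[𝓝 ptO] id := by
        have : f ptO < c₂ := by rw [fO]; linarith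
        filter_upwards [disk_nhds ptO_odisk, (hf.fcont ptO_odisk).eventually (gt_mem_nhds this)] with w hw hw'
        exact hgh w hw (le_of_lt hw')
      have d1 : HasFDerivAt h (fderiv ℝ h ptO) ptO := ((hsat _ ptO_odisk).differentiableAt (by simp)).hasFDerivAt
      have d2 : HasFDerivAt g (fderiv ℝ g ptO) (h ptO) := by
        rw [hO]
        exact ((gs.contDiffAt (disk_nhds ptO_odisk)).differentiableAt (by simp)).hasFDerivAt
      have d3 := d2.comp ptO d1
      have d4 : HasFDerivAt (g ∘ h) (ContinuousLinearMap.id ℝ Pt) ptO := (hasFDerivAt_id ptO).congr_of_eventuallyEq e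
      have d5 := d3.unique d4
      have d6 : LinearMap.det ((fderiv ℝ g ptO) : Pt →ₗ[ℝ] Pt) * LinearMap.det ((fderiv ℝ h ptO) : Pt →ₗ[ℝ] Pt) = 1 := by
        rw [← LinearMap.det_comp, ← ContinuousLinearMap.toLinearMap_comp, d5]
        simp
      have d7 := hh.2
      by_contra! hneg
      nlinarith
  refine ⟨g, hGE, ?_⟩
  have hsubA : diskD ∩ f ⁻¹' (Ici c₂) ⊆ diskD ∩ f ⁻¹' (Ici c₁) := fun z hz => ⟨hz.1, h12.le.trans hz.2⟩
  obtain ⟨H₁, a1, a2, a3, a4⟩ := hf.finish (c₂ := c₂) (p := g ∘ h) (γ := fun z => α z + B (h z)) (by linarith)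
    (gs.comp hs hm)
    (by
      refine ContinuousOn.add (hα.mono hsubA) (hBc.comp (hs.continuousOn.mono inter_subset_left) ?_)
      intro z hz
      refine ⟨hm hz.1, ?_⟩
      change c₁ ≤ f (h z)
      rw [hfh z hz.1]
      exact (hsubA hz).2)
    (by
      intro z hz hz2
      have h4 := hk z hz (by linarith)
      beta_reduce
      rw [B1 (h z) (by rw [hfh z hz]; exact hz2.le), h4.2.2.2.1]; ring)
    (by
      intro z hz hz2
      have h4 := hαe z hz (by linarith)
      rw [← Φ.φ_add z hz, h4]
      exact (g2 (h z) (hm hz) (by rw [hfh z hz]; linarith)).symm)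
    hgh
  obtain ⟨H₂, b1, b2, b3, b4⟩ := hf.finish (c₂ := c₂) (p := h ∘ g) (γ := fun z => B z + α (g z)) (by linarith)
    (hs.comp gs (fun z hz => (gD z hz).1))
    (by
      refine ContinuousOn.add (hBc.mono hsubA) (hα.comp (gs.continuousOn.mono inter_subset_left) ?_)
      intro z hz
      refine ⟨(gD z hz.1).1, ?_⟩
      rw [(gD z hz.1).2]
      exact (hsubA hz).2)
    (by
      intro z hz hz2
      beta_reduce
      rw [B1 z hz2.le, g1 z hz2.le]; ring)
    (by
      intro z hz hz2
      rw [← Φ.φ_add z hz, ← g2 z hz (by linarith)]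
      exact hαe (g z) (gD z hz).1 (by rw [(gD z hz).2]; linarith))
    hhg
  exact ⟨H₁, H₂, a1, b1, fun t ht => ⟨a2 t ht, b2 t ht⟩, a3, a4, b3, b4⟩
end

/-- for every `h ∈ E⁺(F)` there is `g ∈ E⁺(F)` such that both `g ∘ h` and
`h ∘ g` can be joined to the identity by paths in `E⁺(F)` (continuous in the compact-open
topology); hence `π₀ E⁺(F)` is a group. -/
theorem pi0_Epl_is_group
    (Φ : TCFlow) (f : Pt → ℝ) (hf : FirstStrongIntegral Φ f)
    (h : Pt → Pt) (hh : EplMem Φ h) :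
    ∃ g : Pt → Pt, EplMem Φ g ∧
      ∃ H₁ H₂ : ℝ → Pt → Pt,
        ContinuousOn (fun p : ℝ × Pt => H₁ p.1 p.2) (Icc (0 : ℝ) 1 ×ˢ diskD) ∧
        ContinuousOn (fun p : ℝ × Pt => H₂ p.1 p.2) (Icc (0 : ℝ) 1 ×ˢ diskD) ∧
        (∀ t ∈ Icc (0 : ℝ) 1, EplMem Φ (H₁ t) ∧ EplMem Φ (H₂ t)) ∧
        (∀ z ∈ diskD, H₁ 0 z = g (h z)) ∧
        (∀ z ∈ diskD, H₁ 1 z = z) ∧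
        (∀ z ∈ diskD, H₂ 0 z = h (g z)) ∧
        (∀ z ∈ diskD, H₂ 1 z = z) := by
  exact main_aux Φ f hf h hh

end
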